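/- arXiv:2602.20736 — 9 statements merged into one kernel-verified Lean document; each statement's English description precedes it below -/
import Mathlib

section
/- Let p be a prime and let O be a valuation ring of characteristic p with maximal ideal m and residue field k = O/m. Then the sequence of k-vector spaces 0 → m/m² → Ω_O ⊗_O k → Ω_k → 0 is exact, where x + m² is sent to dx ⊗ 1 and da ⊗ b is sent to b·d(a + m); in particular the map m/m² → Ω_O ⊗_O k, x + m² ↦ dx ⊗ 1, is injective. -/
open TensorProduct KaehlerDifferential IsLocalRing

open Polynomial in
/-- Adjoining a `p`-th root `b` of an element of `K` to `K` gives an algebra on which `π` is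
injective, as soon as `π b` is not already in `K`. -/
lemma eq_zero_of_mem_adjoin_of_pow_eq_algebraMap {K B k : Type*} [Field K] [CommRing B] [Field k]
    [Algebra K B] [Algebra K k] (p : ℕ) [Fact p.Prime] [CharP k p] (π : B →ₐ[K] k) {b : B} {c : K}
    (hb : b ^ p = algebraMap K B c) (hπ : π b ∉ (algebraMap K k).range)
    {x : B} (hx : x ∈ Algebra.adjoin K {b}) (hx0 : π x = 0) : x = 0 := by
  have hc : π b ^ p = algebraMap K k c := by rw [← map_pow, hb, AlgHom.commutes]
  have irr : Irreducible (X ^ p - C c) := by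
    refine X_pow_sub_C_irreducible_of_prime Fact.out fun d hd ↦ hπ ⟨d, ?_⟩
    apply frobenius_inj k p
    rw [frobenius_def, frobenius_def, hc, ← hd, map_pow]
  rw [Algebra.adjoin_singleton_eq_range_aeval] at hx
  obtain ⟨f, rfl⟩ := hx
  have hf : aeval (π b) f = 0 := by rw [aeval_algHom_apply]; exact hx0
  have hmin : minpoly K (π b) = X ^ p - C c :=
    (minpoly.eq_of_irreducible_of_monic irr (by simp [hc])
      (monic_X_pow_sub_C c (Fact.out : p.Prime).ne_zero)).symm
  obtain ⟨g, rfl⟩ := hmin ▸ minpoly.dvd K (π b) hf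
  simp [hb]

/-- A field of characteristic `p` lifts along any surjection from a ring of characteristic `p`
whose kernel is killed by Frobenius. -/
theorem exists_ringHom_section_of_pow_eq_zero {B k : Type*} [CommRing B] [Field k]
    (p : ℕ) [Fact p.Prime] [CharP B p] [CharP k p] (π : B →+* k) (hπ : Function.Surjective π)
    (hker : ∀ x, π x = 0 → x ^ p = 0) : ∃ g : k →+* B, π.comp g = RingHom.id k := by
  have hp : p.Prime := Fact.out
  obtain ⟨S, hFS, hS⟩ := zorn_le_nonempty₀ {S : Subring B | ∀ x ∈ S, π x = 0 → x = 0}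
    (by
      intro c hc hchain y hy
      refine ⟨sSup c, fun x hx ↦ ?_, fun z hz ↦ le_sSup hz⟩
      obtain ⟨s, hs, hxs⟩ := (Subring.mem_sSup_of_directedOn ⟨y, hy⟩ hchain.directedOn).1 hx
      exact hc hs x hxs)
    (frobenius B p).range (by
      rintro _ ⟨b, rfl⟩ hb
      rw [frobenius_def] at hb ⊢
      exact hker b (by simpa [hp.ne_zero] using hb))
  have hpow (b : B) : b ^ p ∈ S := hFS ⟨b, rfl⟩
  have hinj : Function.Injective (π.comp S.subtype) := by
    rw [injective_iff_map_eq_zero]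
    exact fun x hx ↦ Subtype.ext (hS.prop x x.2 hx)
  have hunit (x : B) (hx : π x ≠ 0) : IsUnit x := by
    obtain ⟨y, hy⟩ := hπ (π x)⁻¹
    have : (x * y - 1) ^ p = 0 := hker _ (by simp [hy, hx])
    rw [sub_pow_char, one_pow, sub_eq_zero, mul_pow] at this
    exact (isUnit_pow_iff hp.ne_zero).1 (.of_mul_eq_one _ this)
  have hfield : IsField S := by
    refine ⟨⟨0, 1, fun h ↦ ?_⟩, mul_comm, fun {a} ha ↦ ?_⟩
    · exact zero_ne_one (α := k) (by simpa using congrArg (π.comp S.subtype) h)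
    · obtain ⟨y, hy⟩ := (hunit a fun h ↦ ha (Subtype.ext (hS.prop a a.2 h))).exists_right_inv
      refine ⟨a ^ (p - 1) * ⟨y ^ p, hpow y⟩, Subtype.ext ?_⟩
      push_cast
      rw [← mul_assoc, mul_pow_sub_one hp.ne_zero, ← mul_pow, hy, one_pow]
  have hsurj : Function.Surjective (π.comp S.subtype) := by
    intro z
    obtain ⟨b, rfl⟩ := hπ z
    by_contra hb
    let : Field S := hfield.toField
    let : Algebra S k := (π.comp S.subtype).toAlgebra
    let π' : B →ₐ[S] k := { π with commutes' := fun _ ↦ rfl }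
    have hbS : b ∈ S := by
      refine hS.le_of_ge (y := (Algebra.adjoin S {b}).toSubring) (fun x hx hx0 ↦ ?_)
        (fun x hx ↦ (Algebra.adjoin S {b}).algebraMap_mem ⟨x, hx⟩)
        (Algebra.self_mem_adjoin_singleton S b)
      exact eq_zero_of_mem_adjoin_of_pow_eq_algebraMap p π' (c := ⟨b ^ p, hpow b⟩) rfl hb hx hx0
    exact hb ⟨⟨b, hbS⟩, rfl⟩
  let e := RingEquiv.ofBijective (π.comp S.subtype) ⟨hinj, hsurj⟩
  exact ⟨S.subtype.comp e.symm.toRingHom, RingHom.ext e.apply_symm_apply⟩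

/-- For a surjection from a ring of characteristic `p` onto a field, the conormal sequence is exact
on the left. -/
theorem kerCotangentToTensor_injective_of_charP {A k : Type*} [CommRing A] [Field k]
    [Algebra A k] (p : ℕ) [Fact p.Prime] [CharP A p] (h : Function.Surjective (algebraMap A k)) :
    Function.Injective (kerCotangentToTensor ℤ A k) := by
  let f := (IsScalarTower.toAlgHom ℤ A k).kerSquareLift
  have hf : Function.Surjective f := Ideal.Quotient.lift_surjective_of_surjective _ _ h
  have := f.toRingHom.domain_nontrivial
  have hp : p.Prime := Fact.out
  have : CharP (A ⧸ RingHom.ker (IsScalarTower.toAlgHom ℤ A k).toRingHom ^ 2) p :=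
    .of_ringHom_of_ne_zero ((algebraMap A _).comp (ZMod.castHom dvd_rfl A)) p hp.ne_zero
  have : CharP k p :=
    .of_ringHom_of_ne_zero ((algebraMap A k).comp (ZMod.castHom dvd_rfl A)) p hp.ne_zero
  obtain ⟨g, hg⟩ := exists_ringHom_section_of_pow_eq_zero p f.toRingHom hf fun x hx ↦ by
    have hx' : x ∈ RingHom.ker f.toRingHom := hx
    have hx2 := Ideal.pow_mem_pow hx' 2
    rw [AlgHom.ker_kerSquareLift, Ideal.cotangentIdeal_square] at hx2
    exact pow_eq_zero_of_le hp.two_le hx2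
  obtain ⟨l, hl⟩ := (retractionKerCotangentToTensorEquivSection (R := ℤ) h).symm
    ⟨g.toIntAlgHom, AlgHom.ext fun x ↦ RingHom.congr_fun hg x⟩
  exact Function.LeftInverse.injective (LinearMap.congr_fun hl)

theorem stmt0 (p : ℕ) (hp : p.Prime)
    (O : Type*) [CommRing O] [IsDomain O] [ValuationRing O] [CharP O p] :
    RingHom.ker (algebraMap O (ResidueField O)) = maximalIdeal O ∧
    Function.Injective (kerCotangentToTensor ℤ O (ResidueField O)) ∧
    Function.Exact (kerCotangentToTensor ℤ O (ResidueField O))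
      (KaehlerDifferential.mapBaseChange ℤ O (ResidueField O)) ∧
    Function.Surjective (KaehlerDifferential.mapBaseChange ℤ O (ResidueField O)) := by
  have : Fact p.Prime := ⟨hp⟩
  have h : Function.Surjective (algebraMap O (ResidueField O)) := residue_surjective
  exact ⟨ker_residue, kerCotangentToTensor_injective_of_charP p h,
    exact_kerCotangentToTensor_mapBaseChange ℤ O _ h, mapBaseChange_surjective ℤ O _ h⟩
end

section
/- Let p be a prime, C a field of characteristic p, and O a valuation ring containing C as a subring, with maximal ideal m and residue field k = O/m. Assume that m is not a principal ideal, and that the canonical map ι : Ω_C ⊗_C k → Ω_O ⊗_O k is injective. Then the canonical map Ω_C ⊗_C k → Ω_k is injective, i.e. the residue field k is a separable extension of C. -/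
open TensorProduct KaehlerDifferential IsLocalRing

theorem ValuationRing.isIdempotentElem_maximalIdeal {O : Type*} [CommRing O] [IsDomain O]
    [ValuationRing O] (hnp : ¬ (maximalIdeal O).IsPrincipal) :
    IsIdempotentElem (maximalIdeal O) := by
  refine le_antisymm Ideal.mul_le_left fun x hx => ?_
  have hne : ¬ maximalIdeal O ≤ Ideal.span {x} := fun h =>
    hnp ⟨x, le_antisymm h ((Ideal.span_singleton_le_iff_mem _).2 hx)⟩
  obtain ⟨y, hy, hyx⟩ := SetLike.not_le_iff_exists.1 hne
  rw [Ideal.mem_span_singleton] at hyx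
  obtain ⟨z, rfl⟩ := (ValuationRing.dvd_total x y).resolve_left hyx
  refine Ideal.mul_mem_mul hy ((mem_maximalIdeal z).2 fun hz => hyx ?_)
  exact hz.mul_right_dvd.2 dvd_rfl

theorem KaehlerDifferential.mapBaseChange_injective_of_isIdempotentElem_ker
    (R A B : Type*) [CommRing R] [CommRing A] [CommRing B] [Algebra R A] [Algebra A B]
    [Algebra R B] [IsScalarTower R A B] (hsurj : Function.Surjective (algebraMap A B))
    (hker : IsIdempotentElem (RingHom.ker (algebraMap A B))) :
    Function.Injective (mapBaseChange R A B) := by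
  have := (Ideal.cotangent_subsingleton_iff _).2 hker
  refine (injective_iff_map_eq_zero _).2 fun x hx => ?_
  obtain ⟨y, rfl⟩ := (exact_kerCotangentToTensor_mapBaseChange R A B hsurj x).1 hx
  rw [Subsingleton.elim y 0, map_zero]

theorem stmt3 (p : ℕ) (hp : p.Prime)
    (C : Type*) [Field C] [CharP C p]
    (O : Type*) [CommRing O] [IsDomain O] [ValuationRing O] [Algebra C O]
    (hnp : ¬ (maximalIdeal O).IsPrincipal)
    (ι : (ResidueField O ⊗[C] Ω[C⁄ℤ]) →ₗ[ResidueField O] (ResidueField O ⊗[O] Ω[O⁄ℤ]))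
    (hι : ∀ (x : ResidueField O) (c : C),
      ι (x ⊗ₜ KaehlerDifferential.D ℤ C c) = x ⊗ₜ KaehlerDifferential.D ℤ O (algebraMap C O c))
    (hinj : Function.Injective ι) :
    Function.Injective (KaehlerDifferential.mapBaseChange ℤ C (ResidueField O)) := by
  have hO : Function.Injective (mapBaseChange ℤ O (ResidueField O)) := by
    refine mapBaseChange_injective_of_isIdempotentElem_ker _ _ _ residue_surjective ?_
    rw [ResidueField.algebraMap_eq, ker_residue]
    exact ValuationRing.isIdempotentElem_maximalIdeal hnp
  have hcomp : mapBaseChange ℤ C (ResidueField O) = mapBaseChange ℤ O (ResidueField O) ∘ₗ ι := by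
    refine TensorProduct.AlgebraTensorModule.curry_injective ?_
    ext x
    have hD : ∀ y, mapBaseChange ℤ C (ResidueField O) (1 ⊗ₜ y) =
        mapBaseChange ℤ O (ResidueField O) (ι (1 ⊗ₜ y)) := fun y => by
      have hy : y ∈ Submodule.span C (Set.range (D ℤ C)) := by simp [span_range_derivation]
      induction hy using Submodule.span_induction with
      | mem y h =>
        obtain ⟨c, rfl⟩ := h
        simp [hι, IsScalarTower.algebraMap_apply C O (ResidueField O)]
      | zero => simp
      | add y z _ _ hy hz => simp only [tmul_add, map_add, hy, hz]
      | smul c y _ hy =>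
        rw [TensorProduct.tmul_smul, ← algebraMap_smul (ResidueField O) c, map_smul, map_smul,
          map_smul, hy]
    exact hD _
  rw [hcomp]
  exact hO.comp hinj
end

section
/- Let p be a prime, C a field of characteristic p, and O a valuation ring containing C as a subring, with maximal ideal m, residue field k = O/m, and fraction field K. If the canonical map ι : Ω_C ⊗_C k → Ω_O ⊗_O k is injective, then the natural map Ω_C ⊗_C K → Ω_K is injective, i.e. the field of fractions K is a separable extension of C. -/
open TensorProduct KaehlerDifferential IsLocalRing

theorem exists_forall_sub_nsmul_mem_of_map_nonneg {A Γ : Type*} [AddCommGroup A] [AddCommGroup Γ]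
    [LinearOrder Γ] [IsOrderedAddMonoid Γ] (H : AddSubgroup A) (v : A →+ Γ) (p : ℕ)
    (hcyc : ∀ x ∉ H, ∀ y, ∃ l < p, y - l • x ∈ H) (x₀ : A) (hx₀ : x₀ ∉ H)
    (S : Set A) (hS : S.Finite) (hpos : ∀ s ∈ S, 0 ≤ v s) :
    ∃ δ ∉ H, 0 ≤ v δ ∧ ∀ s ∈ S, ∃ l : ℕ, s - l • δ ∈ H ∧ l • v δ ≤ v s := by
  classical
  by_cases hker : ∃ δ ∉ H, v δ = 0
  · obtain ⟨δ, hδ, h0⟩ := hker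
    refine ⟨δ, hδ, h0.ge, fun s hs => ?_⟩
    obtain ⟨l, -, hl⟩ := hcyc δ hδ s
    exact ⟨l, hl, by simpa [h0] using hpos s hs⟩
  push Not at hker
  wlog hx₀' : 0 < v x₀ generalizing x₀
  · refine this (-x₀) (by simpa using hx₀) ?_
    rw [map_neg, Left.neg_pos_iff]
    exact lt_of_le_of_ne (not_lt.mp hx₀') (hker x₀ hx₀)
  let S' : Set A := insert x₀ (S \ H)
  have hS' : S'.Finite := (hS.subset Set.sdiff_subset).insert _
  have hS'mem : ∀ s ∈ S', s ∉ H ∧ 0 < v s := by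
    rintro s (rfl | ⟨hs, hsH⟩)
    · exact ⟨hx₀, hx₀'⟩
    · exact ⟨hsH, lt_of_le_of_ne (hpos s hs) (Ne.symm (hker s hsH))⟩
  have red : (∃ δ ∉ H, 0 ≤ v δ ∧ ∀ s ∈ S', ∃ l : ℕ, s - l • δ ∈ H ∧ l • v δ ≤ v s) →
      ∃ δ ∉ H, 0 ≤ v δ ∧ ∀ s ∈ S, ∃ l : ℕ, s - l • δ ∈ H ∧ l • v δ ≤ v s := by
    rintro ⟨δ, h1, h2, h3⟩
    refine ⟨δ, h1, h2, fun s hs => ?_⟩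
    by_cases hsH : s ∈ H
    · exact ⟨0, by simpa using hsH, by simpa using hpos s hs⟩
    · exact h3 s (Or.inr ⟨hs, hsH⟩)
  apply red
  obtain ⟨m, hmS, hm⟩ := hS'.exists_minimalFor v S' ⟨x₀, Or.inl rfl⟩
  have hm : ∀ s ∈ S', v m ≤ v s := fun s hs => (le_total (v m) (v s)).elim id (hm hs)
  by_cases h1 : ∃ ε ∉ H, 0 < v ε ∧ p • v ε ≤ v m
  · obtain ⟨ε, hε, hε0, hle⟩ := h1
    refine ⟨ε, hε, hε0.le, fun s hs => ?_⟩
    obtain ⟨l, hl, hlH⟩ := hcyc ε hε s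
    exact ⟨l, hlH, (nsmul_le_nsmul_left hε0.le hl.le).trans (hle.trans (hm s hs))⟩
  have h2 : ∃ δ ∉ H, 0 < v δ ∧ ∀ ε ∉ H, 0 < v ε → v δ < 2 • v ε := by
    by_contra! hcon
    have : ∀ n : ℕ, ∃ ε ∉ H, 0 < v ε ∧ (2 ^ n) • v ε ≤ v m := by
      intro n
      induction n with
      | zero => exact ⟨m, (hS'mem m hmS).1, (hS'mem m hmS).2, by simp⟩
      | succ n ih =>
        obtain ⟨ε, hε, h0, hle⟩ := ih
        obtain ⟨ε', hε', h0', hle'⟩ := hcon ε hε h0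
        refine ⟨ε', hε', h0', ?_⟩
        rw [pow_succ, mul_smul]
        exact (nsmul_le_nsmul_right hle' _).trans hle
    obtain ⟨ε, hε, h0, hle⟩ := this p
    exact h1 ⟨ε, hε, h0, (nsmul_le_nsmul_left h0.le Nat.lt_two_pow_self.le).trans hle⟩
  obtain ⟨δ, hδ, hδ0, hδmin⟩ := h2
  have key : ∀ s ∈ S', ∃ l : ℕ, s - (l + 1) • δ ∈ H ∧ 0 < v (s - l • δ) := by
    intro s hs
    have hex : ∃ l : ℕ, s - l • δ ∈ H := (hcyc δ hδ s).imp fun l hl => hl.2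
    obtain ⟨l, hl⟩ : ∃ l, Nat.find hex = l + 1 := by
      refine Nat.exists_eq_succ_of_ne_zero fun h => (hS'mem s hs).1 ?_
      simpa [h] using Nat.find_spec hex
    refine ⟨l, hl ▸ Nat.find_spec hex, ?_⟩
    have : ∀ k, k ≤ l → 0 < v (s - k • δ) := by
      intro k
      induction k with
      | zero => intro _; simpa using (hS'mem s hs).2
      | succ k ih =>
        intro hk
        have hpk := ih (by omega)
        have hk1 : s - (k + 1) • δ ∉ H := Nat.find_min hex (by omega)
        have hk0 : s - k • δ ∉ H := Nat.find_min hex (by omega)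
        by_contra hneg
        have hlt : 0 < v ((k + 1) • δ - s) := by
          rw [← neg_sub, map_neg, Left.neg_pos_iff]
          exact lt_of_le_of_ne (not_lt.mp hneg) (hker _ hk1)
        have e1 := hδmin _ hk0 hpk
        have e2 := hδmin _ (fun h => hk1 (by simpa using neg_mem h)) hlt
        have e3 : v (s - k • δ) + v ((k + 1) • δ - s) = v δ := by
          rw [← map_add]; congr 1; rw [succ_nsmul]; abel
        have e4 := add_lt_add e1 e2
        rw [← smul_add, e3, two_nsmul] at e4
        exact lt_irrefl _ e4
    exact this l le_rfl
  choose! l hl hlpos using key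
  obtain ⟨δ', hδ'S, hδ'⟩ := ((hS'.image fun s => s - l s • δ).insert δ).exists_minimalFor v _
    ⟨δ, Or.inl rfl⟩
  have hδ' : ∀ x ∈ insert δ ((fun s => s - l s • δ) '' S'), v δ' ≤ v x :=
    fun s hs => (le_total (v δ') (v s)).elim id (hδ' hs)
  have hδH : δ - δ' ∈ H := by
    obtain rfl | ⟨s, hs, rfl⟩ := hδ'S
    · simp
    · have := neg_mem (hl s hs)
      rw [succ_nsmul] at this
      convert this using 1
      simp only
      abel
  have hδ'0 : 0 < v δ' := by
    obtain rfl | ⟨s, hs, rfl⟩ := hδ'S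
    · exact hδ0
    · exact hlpos s hs
  refine ⟨δ', fun h => hδ (by simpa using add_mem hδH h), hδ'0.le, fun s hs => ⟨l s + 1, ?_, ?_⟩⟩
  · have := add_mem (hl s hs) (nsmul_mem hδH (l s + 1))
    rw [smul_sub] at this
    simpa using this
  · have a1 := hδ' δ (Or.inl rfl)
    have a2 := hδ' _ (Or.inr ⟨s, hs, rfl⟩)
    rw [succ_nsmul]
    calc l s • v δ' + v δ' ≤ l s • v δ + v (s - l s • δ) :=
          add_le_add (nsmul_le_nsmul_right a1 _) a2
      _ = v s := by simp

theorem Polynomial.exists_first_maximal_coeff {K Γ₀ : Type*} [Field K]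
    [LinearOrderedCommGroupWithZero Γ₀] (v : Valuation K Γ₀) (f : Polynomial K) :
    ∃ i ≤ f.natDegree, (∀ j, v (f.coeff j) ≤ v (f.coeff i)) ∧
      ∀ j < i, v (f.coeff j) < v (f.coeff i) := by
  classical
  have hex : ∃ i, i ≤ f.natDegree ∧ ∀ j, v (f.coeff j) ≤ v (f.coeff i) := by
    obtain ⟨i, hi, hmax⟩ := (Finset.range (f.natDegree + 1)).exists_max_image
      (fun i => v (f.coeff i)) ⟨0, by simp⟩
    refine ⟨i, by simpa [Nat.lt_succ_iff] using hi, fun j => ?_⟩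
    by_cases hj : j ≤ f.natDegree
    · exact hmax j (by simpa [Nat.lt_succ_iff] using hj)
    · simp [f.coeff_eq_zero_of_natDegree_lt (not_le.mp hj)]
  obtain ⟨h1, h2⟩ := Nat.find_spec hex
  refine ⟨Nat.find hex, h1, h2, fun j hj => lt_of_le_of_ne (h2 j) fun h => ?_⟩
  exact Nat.find_min hex hj ⟨hj.le.trans h1, fun k => h ▸ h2 k⟩

theorem Polynomial.map_coeff_mul_of_first_maximal {K Γ₀ : Type*} [Field K]
    [LinearOrderedCommGroupWithZero Γ₀] (v : Valuation K Γ₀) {f g : Polynomial K} {i j : ℕ}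
    (hf : ∀ k, v (f.coeff k) ≤ v (f.coeff i)) (hf' : ∀ k < i, v (f.coeff k) < v (f.coeff i))
    (hg : ∀ k, v (g.coeff k) ≤ v (g.coeff j)) (hg' : ∀ k < j, v (g.coeff k) < v (g.coeff j))
    (hf0 : f.coeff i ≠ 0) (hg0 : g.coeff j ≠ 0) :
    v ((f * g).coeff (i + j)) = v (f.coeff i) * v (g.coeff j) := by
  classical
  have hfp : 0 < v (f.coeff i) := by simpa [zero_lt_iff] using hf0
  have hgp : 0 < v (g.coeff j) := by simpa [zero_lt_iff] using hg0
  rw [Polynomial.coeff_mul, ← Finset.add_sum_erase _ _ (a := (i, j)) (by simp), ← map_mul]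
  refine Valuation.map_add_eq_of_lt_left v ?_
  refine Valuation.map_sum_lt v (by simp [hf0, hg0]) ?_
  rintro ⟨k, l⟩ hkl
  obtain ⟨hne, hsum⟩ := Finset.mem_erase.1 hkl
  replace hsum : k + l = i + j := by simpa using hsum
  rw [map_mul, map_mul]
  rcases lt_or_ge k i with h | h
  · calc _ ≤ v (f.coeff k) * v (g.coeff j) := by gcongr; exact hg l
      _ < _ := by gcongr; exact hf' k h
  · have : l < j := by
      refine lt_of_le_of_ne (by omega) fun hlj => hne ?_
      rw [hlj, Nat.add_right_cancel (hlj ▸ hsum : k + j = i + j)]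
    calc _ ≤ v (f.coeff i) * v (g.coeff l) := by gcongr; exact hf k
      _ < _ := by gcongr; exact hg' l this

theorem Valuation.map_natCast_eq_one {K Γ₀ : Type*} [Field K]
    [LinearOrderedCommGroupWithZero Γ₀] (v : Valuation K Γ₀) (p : ℕ) [Fact p.Prime] [CharP K p]
    (n : ℕ) (hn : (n : K) ≠ 0) : v (n : K) = 1 := by
  have h : (n : K) ^ (p - 1) = 1 := by
    have h1 : (n : ZMod p) ≠ 0 := by
      intro h
      rw [ZMod.natCast_eq_zero_iff] at h
      exact hn ((CharP.cast_eq_zero_iff K p n).2 h)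
    have := congrArg (ZMod.castHom dvd_rfl K) (ZMod.pow_card_sub_one_eq_one h1)
    simpa using this
  have h2 : v (n : K) ^ (p - 1) = 1 := by rw [← map_pow, h, map_one]
  have hp := (Fact.out : p.Prime).two_le
  exact (pow_eq_one_iff_of_nonneg zero_le (by omega)).1 h2

theorem Polynomial.coeff_taylor_natDegree_sub_one {K : Type*} [Field K] (f : Polynomial K) (y : K)
    (d : ℕ) (hd : f.natDegree = d + 1) :
    (taylor y f).coeff d = f.coeff d + ((d + 1 : ℕ) : K) * f.leadingCoeff * y := by
  rw [taylor_coeff]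
  have h1 : (hasseDeriv d f).natDegree ≤ 1 := by
    refine (natDegree_hasseDeriv_le f d).trans (by omega)
  rw [eval_eq_sum_range' (n := 2) (by omega)]
  simp only [Finset.sum_range_succ, hasseDeriv_coeff, Polynomial.leadingCoeff, hd]
  simp [add_comm 1 d]

open Polynomial in
/-- Every polynomial of degree less than `p` over `L` admits `b` in `L` such that the terms of its
Taylor expansion at `y`, evaluated at radius `y - b`, are dominated by its value at `y`. -/
theorem exists_taylor_coeff_le {K Γ₀ : Type*} [Field K]
    [LinearOrderedCommGroupWithZero Γ₀] (v : Valuation K Γ₀) (p : ℕ) [hp : Fact p.Prime] [CharP K p]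
    (L : Subfield K) (y : K) (hy : y ∉ L) (hyp : y ^ p ∈ L) (f : L[X]) (hf : f.natDegree < p) :
    ∃ b ∈ L, ∀ b' ∈ L, v (y - b') ≤ v (y - b) → ∀ i,
      v ((taylor y (f.map L.subtype)).coeff i * (y - b') ^ i) ≤ v (eval₂ L.subtype y f) := by
  induction hd : f.natDegree using Nat.strong_induction_on generalizing f with
  | _ d ih =>
  obtain rfl | ⟨d, rfl⟩ : d = 0 ∨ ∃ e, d = e + 1 := by cases d <;> simp
  · refine ⟨0, L.zero_mem, fun b' _ _ i => ?_⟩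
    rw [natDegree_eq_zero] at hd
    obtain ⟨x, rfl⟩ := hd
    rcases i with _ | i <;> simp [coeff_C]
  set P : L[X] := X ^ p - C (⟨y ^ p, hyp⟩ : L) with hP
  have hPdeg : P.natDegree = p := natDegree_X_pow_sub_C
  have hf0 : f ≠ 0 := by rintro rfl; simp at hd
  have hrd : (P % f).natDegree < d + 1 := hd ▸ natDegree_mod_lt P (by omega)
  obtain ⟨b₀, hb₀, hgood⟩ := ih _ hrd (P % f) (by omega) rfl
  set q := P / f with hq
  set r := P % f with hr
  have hdiv : f * q + r = P := EuclideanDomain.div_add_mod P f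
  have hq0 : q ≠ 0 := by
    intro h
    rw [h, mul_zero, zero_add] at hdiv
    rw [hdiv, hPdeg] at hrd
    omega
  have hqd : q.natDegree + (d + 1) = p := by
    have h1 : (f * q).natDegree = p := by
      rw [← hPdeg, ← hdiv, natDegree_add_eq_left_of_natDegree_lt]
      rw [natDegree_mul hf0 hq0]; omega
    rw [natDegree_mul hf0 hq0] at h1
    omega
  have hdK : ((d + 1 : ℕ) : K) ≠ 0 := by
    rw [Ne, CharP.cast_eq_zero_iff K p]
    exact Nat.not_dvd_of_pos_of_lt (by omega) (by omega)
  set u : K := (f.leadingCoeff : K) with hu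
  have hu0 : u ≠ 0 := by simpa [hu] using hf0
  set e : K := - ((f.coeff d : K) / (((d + 1 : ℕ) : K) * u)) with he
  have heL : e ∈ L :=
    L.neg_mem (L.div_mem (f.coeff d).2 (L.mul_mem (natCast_mem L _) f.leadingCoeff.2))
  by_contra! hbad
  have key : ∀ b ∈ L, v (y - b) ≤ v (y - b₀) → v (y - e) < v (y - b) := by
    intro b hb hbb
    obtain ⟨b', hb', hle, i, hi⟩ := hbad b hb
    have ht0 : y - b ≠ 0 := fun h => hy (by rwa [sub_eq_zero.1 h])
    set t := y - b with ht
    let φ : L[X] →+* K[X] := (compRingHom (C t * X)).comp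
      (((taylorAlgHom y : K[X] →ₐ[K] K[X]) : K[X] →+* K[X]).comp (mapRingHom L.subtype))
    have hφc : ∀ (g : L[X]) (i : ℕ), (φ g).coeff i =
        (taylor y (g.map L.subtype)).coeff i * t ^ i := by
      intro g i
      simp [φ, comp_C_mul_X_coeff]
    have hφ0 : ∀ g : L[X], (φ g).coeff 0 = eval₂ L.subtype y g := by
      intro g
      rw [hφc, taylor_coeff_zero, eval_map]; simp
    have hφd : ∀ g : L[X], (φ g).natDegree ≤ g.natDegree := by
      intro g
      refine natDegree_le_iff_coeff_eq_zero.2 fun n hn => ?_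
      rw [hφc, coeff_eq_zero_of_natDegree_lt, zero_mul]
      simpa using hn
    have hφne : ∀ g : L[X], g ≠ 0 → φ g ≠ 0 := by
      intro g hg h
      have := hφc g g.natDegree
      rw [h] at this
      have h2 := coeff_taylor_natDegree (r := y) (f := g.map L.subtype)
      rw [natDegree_map] at h2
      rw [h2] at this
      simp [ht0, hg] at this
    have hφP : φ P = C (t ^ p) * X ^ p := by
      have h1 : φ P = (C t * X + C y) ^ p - C (y ^ p) := by
        simp [φ, hP, taylor_apply]
      have : CharP K[X] p := inferInstance
      rw [h1, add_pow_char]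
      simp [mul_pow]
    have hsum : φ f * φ q + φ r = C (t ^ p) * X ^ p := by
      rw [← map_mul, ← map_add, hdiv, hφP]
    obtain ⟨m, hm, hmax, hmin⟩ := exists_first_maximal_coeff v (φ f)
    obtain ⟨n, hn, hnax, hnin⟩ := exists_first_maximal_coeff v (φ q)
    have hm0 : (φ f).coeff m ≠ 0 := by
      intro h
      refine hφne f hf0 (Polynomial.ext fun k => ?_)
      simpa [h] using hmax k
    have hn0 : (φ q).coeff n ≠ 0 := by
      intro h
      refine hφne q hq0 (Polynomial.ext fun k => ?_)
      simpa [h] using hnax k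
    have hmn := map_coeff_mul_of_first_maximal v hmax hmin hnax hnin hm0 hn0
    have hlt0 : v ((φ f).coeff 0) < v ((φ f).coeff m) := by
      refine lt_of_lt_of_le ?_ (hmax i)
      rw [hφ0]
      refine hi.trans_le ?_
      rw [hφc, map_mul, map_mul, map_pow, map_pow]
      gcongr
    have hr0 : (φ r).coeff 0 = - ((φ f).coeff 0 * (φ q).coeff 0) := by
      have := congrArg (fun g => coeff g 0) hsum
      simp only [coeff_add, mul_coeff_zero, coeff_C_zero, coeff_X_pow] at this
      rw [if_neg hp.out.ne_zero.symm] at this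
      linear_combination this
    have hrlt : v ((φ r).coeff (m + n)) < v ((φ f * φ q).coeff (m + n)) := by
      rw [hmn]
      calc v ((φ r).coeff (m + n)) ≤ v ((φ r).coeff 0) := by
            rw [hφ0, hφc]
            exact hgood b hb hbb _
        _ = v ((φ f).coeff 0) * v ((φ q).coeff 0) := by rw [hr0, Valuation.map_neg, map_mul]
        _ ≤ v ((φ f).coeff 0) * v ((φ q).coeff n) := by gcongr; exact hnax 0
        _ < _ := by
          have : 0 < v ((φ q).coeff n) := by simpa [zero_lt_iff] using hn0
          gcongr
    have hmnp : m + n = p := by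
      by_contra hne
      have h1 : v ((φ f * φ q + φ r).coeff (m + n)) = v ((φ f * φ q).coeff (m + n)) := by
        rw [coeff_add]
        exact Valuation.map_add_eq_of_lt_left v hrlt
      rw [hsum, coeff_C_mul, coeff_X_pow, if_neg hne, mul_zero, map_zero] at h1
      rw [← h1] at hrlt
      exact not_lt_zero hrlt
    have hmd : m = d + 1 := by
      have := hφd f
      have := hφd q
      omega
    have hlast := hmin d (by omega)
    rw [hmd, hφc, hφc, coeff_taylor_natDegree_sub_one _ y d (by simpa using hd)] at hlast
    have h2 := coeff_taylor_natDegree (r := y) (f := f.map L.subtype)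
    rw [natDegree_map, hd] at h2
    rw [h2, leadingCoeff_map, coeff_map] at hlast
    have h3 : L.subtype (f.coeff d) + ((d + 1 : ℕ) : K) * L.subtype f.leadingCoeff * y
        = ((d + 1 : ℕ) : K) * u * (y - e) := by
      simp only [he, Subfield.coe_subtype, ← hu]
      field_simp
      ring
    have hvd : v ((d + 1 : ℕ) : K) = 1 := v.map_natCast_eq_one p _ hdK
    have htd : 0 < v (u * t ^ d) := by simp [zero_lt_iff, hu0, ht0]
    rw [h3, Subfield.coe_subtype, ← hu, pow_succ] at hlast
    have h4 : v (y - e) * v (u * t ^ d) < v t * v (u * t ^ d) := by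
      calc v (y - e) * v (u * t ^ d) = v (((d + 1 : ℕ) : K) * u * (y - e) * t ^ d) := by
            simp only [map_mul, hvd, map_pow, one_mul]; ac_rfl
        _ < v (u * (t ^ d * t)) := hlast
        _ = _ := by simp only [map_mul, map_pow]; ac_rfl
    exact lt_of_mul_lt_mul_right' h4
  have h1 := key b₀ hb₀ le_rfl
  exact lt_irrefl _ (key e heL h1.le)

theorem Subfield.mem_of_zpow_mem_of_not_dvd {K : Type*} [Field K] (L : Subfield K) {p : ℕ}
    (hp : p.Prime) {t : K} (ht0 : t ≠ 0) (htp : t ^ p ∈ L) {j : ℤ} (hj : ¬ (p : ℤ) ∣ j)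
    (h : t ^ j ∈ L) : t ∈ L := by
  obtain ⟨a, b, hab⟩ := (Nat.prime_iff_prime_int.1 hp).irreducible.coprime_iff_not_dvd.2 hj
  have h1 : t = (t ^ p) ^ a * (t ^ j) ^ b := by
    rw [← zpow_natCast, ← zpow_mul, ← zpow_mul, ← zpow_add₀ ht0, mul_comm _ a, mul_comm _ b, hab,
      zpow_one]
  rw [h1]
  exact L.mul_mem (L.zpow_mem htp a) (L.zpow_mem h b)

/-- Finitely many integral monomials `a * t ^ j` over `L` are integral monomials in a single
integral generator `z`. -/
theorem exists_integral_generator_of_monomials {K Γ₀ : Type*} [Field K]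
    [LinearOrderedCommGroupWithZero Γ₀] (v : Valuation K Γ₀) (p : ℕ) [hp : Fact p.Prime]
    (L : Subfield K) (t : K) (ht : t ∉ L) (htp : t ^ p ∈ L)
    (S : Set (K × ℕ)) (hS : S.Finite) (hSL : ∀ s ∈ S, s.1 ∈ L)
    (hv : ∀ s ∈ S, v (s.1 * t ^ s.2) ≤ 1) :
    ∃ z ∉ L, (∃ c ∈ L, ∃ j : ℤ, z = c * t ^ j) ∧ v z ≤ 1 ∧
      ∀ s ∈ S, ∃ c ∈ L, v c ≤ 1 ∧ ∃ l : ℕ, s.1 * t ^ s.2 = c * z ^ l := by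
  classical
  have ht0 : t ≠ 0 := fun h => ht (h ▸ L.zero_mem)
  have hpp := hp.out
  let w : Multiplicative (Additive Lˣ × ℤ) →* Kˣ :=
    { toFun := fun x => Units.map L.subtype.toMonoidHom x.toAdd.1.toMul *
        (Units.mk0 t ht0) ^ x.toAdd.2
      map_one' := by simp
      map_mul' := fun x y => by
        simp only [toAdd_mul, Prod.fst_add, toMul_add, map_mul, Prod.snd_add, zpow_add]
        exact mul_mul_mul_comm _ _ _ _ }
  let V : (Additive Lˣ × ℤ) →+ Additive Γ₀ˣ :=
    - (MonoidHom.toAdditive ((Units.map v.toMonoidWithZeroHom.toMonoidHom).comp w))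
  have hw : ∀ x : Additive Lˣ × ℤ, (w (.ofAdd x) : K) = ((x.1.toMul : L) : K) * t ^ x.2 := by
    intro x; simp [w]
  have hV : ∀ x y : Additive Lˣ × ℤ, V x ≤ V y ↔ v (w (.ofAdd y)) ≤ v (w (.ofAdd x)) := by
    intro x y
    change -_ ≤ -_ ↔ _
    rw [neg_le_neg_iff]
    rfl
  let H : AddSubgroup (Additive Lˣ × ℤ) :=
    (AddSubgroup.zmultiples (p : ℤ)).comap (AddMonoidHom.snd _ _)
  have hH : ∀ x, x ∈ H ↔ (p : ℤ) ∣ x.2 := by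
    intro x
    simp [H, Int.mem_zmultiples_iff]
  let toA : K × ℕ → Additive Lˣ × ℤ := fun s =>
    (if h : ∃ hL : s.1 ∈ L, s.1 ≠ 0 then
      .ofMul (Units.mk0 (⟨s.1, h.1⟩ : L) (fun h0 => h.2 (congrArg Subtype.val h0))) else 0, s.2)
  have htoA : ∀ s ∈ S, s.1 ≠ 0 → (w (.ofAdd (toA s)) : K) = s.1 * t ^ s.2 := by
    intro s hs h0
    rw [hw]
    have : ∃ hL : s.1 ∈ L, s.1 ≠ 0 := ⟨hSL s hs, h0⟩
    simp [toA, this]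
  obtain ⟨δ, hδH, hδ0, hδ⟩ := exists_forall_sub_nsmul_mem_of_map_nonneg H V p (by
      intro x hx y
      rw [hH] at hx
      have hx' : ((x.2 : ℤ) : ZMod p) ≠ 0 := by rwa [Ne, ZMod.intCast_zmod_eq_zero_iff_dvd]
      refine ⟨((y.2 : ZMod p) / (x.2 : ZMod p)).val, ZMod.val_lt _, ?_⟩
      rw [hH, ← ZMod.intCast_zmod_eq_zero_iff_dvd]
      simp [hx']) (0, 1) (by
        rw [hH]
        intro h
        exact hpp.one_lt.ne' (by exact_mod_cast Int.eq_one_of_dvd_one (by positivity) h))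
      (toA '' {s ∈ S | s.1 ≠ 0}) ((hS.subset fun s hs => hs.1).image _) (by
        rintro _ ⟨s, ⟨hs, h0⟩, rfl⟩
        rw [← map_zero V, hV, htoA s hs h0]
        simpa using hv s hs)
  have hδne : (w (.ofAdd δ) : K) ≠ 0 := Units.ne_zero _
  refine ⟨w (.ofAdd δ), ?_, ⟨_, (δ.1.toMul : L).2, δ.2, hw δ⟩, ?_, ?_⟩
  · intro h
    rw [hH] at hδH
    refine ht (L.mem_of_zpow_mem_of_not_dvd hpp ht0 htp hδH ?_)
    rw [hw] at h
    have h2 := L.mul_mem (L.inv_mem (δ.1.toMul : L).2) h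
    rwa [inv_mul_cancel_left₀] at h2
    simp
  · rw [← map_zero V, hV] at hδ0
    simpa using hδ0
  · intro s hs
    by_cases h0 : s.1 = 0
    · exact ⟨0, L.zero_mem, by simp, 0, by simp [h0]⟩
    obtain ⟨l, hl, hle⟩ := hδ _ ⟨s, ⟨hs, h0⟩, rfl⟩
    refine ⟨(w (.ofAdd (toA s - l • δ)) : K), ?_, ?_, l, ?_⟩
    · rw [hw]
      obtain ⟨k, hk⟩ := (hH _).1 hl
      rw [hk, zpow_mul, zpow_natCast]
      exact L.mul_mem (Subtype.property _) (L.zpow_mem htp k)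
    · rw [← map_nsmul, ← sub_nonneg, ← map_sub, ← map_zero V, hV] at hle
      simpa using hle
    · rw [ofAdd_sub, ofAdd_nsmul, map_div, map_pow, ← htoA s hs h0]
      simp

open Polynomial in
theorem Polynomial.exists_eval₂_eq_sum_integral_terms {K Γ₀ : Type*} [Field K]
    [LinearOrderedCommGroupWithZero Γ₀] (v : Valuation K Γ₀) (L : Subfield K) (y b : K) (hb : b ∈ L)
    (f : L[X]) (h : ∀ i, v ((taylor y (f.map L.subtype)).coeff i * (y - b) ^ i) ≤ 1) :
    ∃ a : ℕ → K, (∀ i, a i ∈ L) ∧ (∀ i, v (a i * (y - b) ^ i) ≤ 1) ∧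
      eval₂ L.subtype y f = ∑ i ∈ Finset.range (f.natDegree + 1), a i * (y - b) ^ i := by
  set g : L[X] := taylor ⟨b, hb⟩ f with hg
  have hgm : g.map L.subtype = taylor b (f.map L.subtype) := by
    rw [hg, map_taylor]; rfl
  refine ⟨fun i => (g.coeff i : K), fun i => (g.coeff i).2, fun i => ?_, ?_⟩
  · have h1 : (g.coeff i : K) = (taylor b (f.map L.subtype)).coeff i := by
      rw [← hgm, coeff_map]; rfl
    have h2 : taylor b (f.map L.subtype) =
        taylor (b - y) (taylor y (f.map L.subtype)) := by rw [taylor_taylor]; simp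
    set F := taylor y (f.map L.subtype) with hF
    change v ((g.coeff i : K) * _) ≤ 1
    rw [h1, h2, taylor_coeff, eval_eq_sum_range, Finset.sum_mul]
    refine Valuation.map_sum_le v fun k _ => ?_
    rw [hasseDeriv_coeff]
    have h3 : ((k + i).choose i : K) * F.coeff (k + i) * (b - y) ^ k * (y - b) ^ i =
        (((k + i).choose i : ℕ) : K) * (-1) ^ k * (F.coeff (k + i) * (y - b) ^ (k + i)) := by
      rw [← neg_sub y b, neg_pow (y - b)]
      ring
    rw [h3, map_mul]
    refine mul_le_one' ?_ (h _)
    rw [map_mul, map_pow, Valuation.map_neg, map_one, one_pow, mul_one]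
    exact natCast_mem v.integer _
  · have h1 : eval₂ L.subtype y f = (g.map L.subtype).eval (y - b) := by
      rw [hgm, taylor_eval, eval_map]; simp
    rw [h1, eval_eq_sum_range' (n := f.natDegree + 1)]
    · simp
    · simp [hg]

theorem exists_integral_generator_of_finite {K Γ₀ : Type*} [Field K]
    [LinearOrderedCommGroupWithZero Γ₀] (v : Valuation K Γ₀) (p : ℕ) [hp : Fact p.Prime] [CharP K p]
    (L : Subfield K) (y : K) (hy : y ∉ L) (hyp : y ^ p ∈ L) (S : Set K) (hS : S.Finite)
    (hSL : ∀ s ∈ S, s ∈ IntermediateField.adjoin L {y}) (hv : ∀ s ∈ S, v s ≤ 1) :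
    ∃ z ∉ L, z ∈ IntermediateField.adjoin L {y} ∧ v z ≤ 1 ∧
      ∃ T : Set K, T.Finite ∧ (∀ c ∈ T, c ∈ L ∧ v c ≤ 1) ∧
        ∀ s ∈ S, s ∈ Subring.closure (T ∪ {z}) := by
  classical
  have hpp := hp.out
  have hrep : ∀ s ∈ S, ∃ f : Polynomial L, f.natDegree < p ∧ f.eval₂ L.subtype y = s := by
    intro s hs
    set P : Polynomial L := Polynomial.X ^ p - Polynomial.C (⟨y ^ p, hyp⟩ : L) with hP
    have hPm : P.Monic := Polynomial.monic_X_pow_sub_C _ hpp.ne_zero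
    have hPd : P.natDegree = p := Polynomial.natDegree_X_pow_sub_C
    have hPy : Polynomial.eval₂ L.subtype y P = 0 := by simp [hP]
    have hint : IsIntegral L y := ⟨P, hPm, hPy⟩
    have h1 := hSL s hs
    rw [← IntermediateField.mem_toSubalgebra,
      IntermediateField.adjoin_simple_toSubalgebra_of_isAlgebraic hint.isAlgebraic,
      Algebra.adjoin_singleton_eq_range_aeval] at h1
    obtain ⟨g, rfl⟩ := h1
    refine ⟨g %ₘ P, ?_, ?_⟩
    · conv_rhs => rw [← hPd]
      exact Polynomial.natDegree_modByMonic_lt _ hPm (by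
        intro h; rw [h, Polynomial.natDegree_one] at hPd; exact hpp.ne_zero hPd.symm)
    · have := Polynomial.modByMonic_add_div g P
      have h2 := congrArg (Polynomial.eval₂ L.subtype y) this
      rw [Polynomial.eval₂_add, Polynomial.eval₂_mul, hPy, zero_mul, add_zero] at h2
      exact h2
  choose! f hfd hfs using hrep
  have hgood : ∀ s ∈ S, ∃ b ∈ L, ∀ b' ∈ L, v (y - b') ≤ v (y - b) → ∀ i,
      v ((Polynomial.taylor y ((f s).map L.subtype)).coeff i * (y - b') ^ i) ≤ 1 := by
    intro s hs
    obtain ⟨b, hb, h⟩ := exists_taylor_coeff_le v p L y hy hyp (f s) (hfd s hs)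
    exact ⟨b, hb, fun b' hb' hle i => (h b' hb' hle i).trans ((hfs s hs).symm ▸ hv s hs)⟩
  choose! b hbL hb using hgood
  obtain ⟨b₀, hb₀S, hb₀⟩ := ((hS.image b).insert 0).exists_minimalFor (fun x => v (y - x)) _
    ⟨0, Or.inl rfl⟩
  have hb₀ : ∀ s ∈ S, v (y - b₀) ≤ v (y - b s) := fun s hs =>
    (le_total (v (y - b₀)) (v (y - b s))).elim id (hb₀ (Or.inr ⟨s, hs, rfl⟩))
  have hb₀L : b₀ ∈ L := by
    obtain rfl | ⟨s, hs, rfl⟩ := hb₀S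
    · exact L.zero_mem
    · exact hbL s hs
  have hexp := fun s (hs : s ∈ S) => Polynomial.exists_eval₂_eq_sum_integral_terms v L y b₀ hb₀L
    (f s) (hb s hs b₀ hb₀L (hb₀ s hs))
  choose! a haL hav hsum using hexp
  have ht : y - b₀ ∉ L := fun h => hy (by simpa using L.add_mem h hb₀L)
  have htp : (y - b₀) ^ p ∈ L := by
    rw [sub_pow_char]
    exact L.sub_mem hyp (L.pow_mem hb₀L p)
  obtain ⟨z, hzL, ⟨c, hc, j, hz⟩, hvz, hmon⟩ := exists_integral_generator_of_monomials v p L _ ht htp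
    (⋃ s ∈ S, ⋃ i ∈ Finset.range ((f s).natDegree + 1), {(a s i, i)})
    (hS.biUnion fun s _ => Set.Finite.biUnion (Finset.finite_toSet _) fun i _ => Set.finite_singleton _)
    (by simp only [Set.mem_iUnion]; rintro _ ⟨s, hs, i, hi, rfl⟩; exact haL s hs i)
    (by simp only [Set.mem_iUnion]; rintro _ ⟨s, hs, i, hi, rfl⟩; exact hav s hs i)
  have hmon' : ∀ s ∈ S, ∀ i ∈ Finset.range ((f s).natDegree + 1), ∃ c ∈ L, v c ≤ 1 ∧
      ∃ l : ℕ, a s i * (y - b₀) ^ i = c * z ^ l := by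
    intro s hs i hi
    refine hmon (a s i, i) ?_
    simp only [Set.mem_iUnion]
    exact ⟨s, hs, i, hi, rfl⟩
  choose! d hdL hdv l hd using hmon'
  refine ⟨z, hzL, ?_, hvz, ⋃ s ∈ S, ⋃ i ∈ Finset.range ((f s).natDegree + 1), {d s i}, ?_, ?_, ?_⟩
  · rw [hz]
    have hLm : ∀ x ∈ L, x ∈ IntermediateField.adjoin L {y} := fun x hx =>
      (IntermediateField.adjoin L {y}).algebraMap_mem ⟨x, hx⟩
    exact mul_mem (hLm c hc) (zpow_mem (sub_mem (IntermediateField.mem_adjoin_simple_self L y)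
      (hLm _ hb₀L)) j)
  · exact hS.biUnion fun s _ => Set.Finite.biUnion (Finset.finite_toSet _)
      fun i _ => Set.finite_singleton _
  · simp only [Set.mem_iUnion]
    rintro _ ⟨s, hs, i, hi, rfl⟩
    exact ⟨hdL s hs i hi, hdv s hs i hi⟩
  · intro s hs
    rw [← hfs s hs, hsum s hs]
    refine sum_mem fun i hi => ?_
    rw [hd s hs i hi]
    refine mul_mem (Subring.subset_closure (Set.mem_union_left _ ?_))
      (pow_mem (Subring.subset_closure (Set.mem_union_right _ (Set.mem_singleton z))) _)
    simp only [Set.mem_iUnion]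
    exact ⟨s, hs, i, hi, rfl⟩

theorem Subfield.isIntegral_of_pow_mem {K : Type*} [Field K] {p : ℕ} (hp : p ≠ 0)
    (L : Subfield K) {x : K} (hx : x ^ p ∈ L) : IsIntegral L x := by
  refine ⟨Polynomial.X ^ p - Polynomial.C ⟨x ^ p, hx⟩, Polynomial.monic_X_pow_sub_C _ hp, ?_⟩
  rw [Polynomial.eval₂_sub, Polynomial.eval₂_C, Polynomial.eval₂_X_pow]
  exact sub_self _

theorem Subfield.finrank_adjoin_simple_of_pow_mem {K : Type*} [Field K] (p : ℕ)
    [hp : Fact p.Prime] [CharP K p] (L : Subfield K) {x : K} (hxp : x ^ p ∈ L) (hx : x ∉ L) :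
    Module.finrank L (IntermediateField.adjoin L {x}) = p := by
  have hpp := hp.out
  have hirr : Irreducible (Polynomial.X ^ p - Polynomial.C (⟨x ^ p, hxp⟩ : L)) := by
    refine X_pow_sub_C_irreducible_of_prime hpp fun b hb => hx ?_
    have h1 : (b : K) ^ p = x ^ p := congrArg Subtype.val hb
    have h2 : (b : K) = x := frobenius_inj K p h1
    exact h2 ▸ b.2
  have h0 : Polynomial.aeval x (Polynomial.X ^ p - Polynomial.C (⟨x ^ p, hxp⟩ : L)) = 0 := by
    rw [map_sub, map_pow, Polynomial.aeval_X, Polynomial.aeval_C]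
    exact sub_self _
  rw [IntermediateField.adjoin.finrank (L.isIntegral_of_pow_mem hpp.ne_zero hxp),
    ← minpoly.eq_of_irreducible_of_monic hirr h0 (Polynomial.monic_X_pow_sub_C _ hpp.ne_zero),
    Polynomial.natDegree_X_pow_sub_C]

theorem Subfield.adjoin_singleton_eq_top_of_maximal {K : Type*} [Field K] (p : ℕ)
    [hp : Fact p.Prime] [CharP K p] (L : Subfield K) (hL : ∀ x : K, x ^ p ∈ L) (z : K)
    (hz : z ∉ L) (hM : ∀ M : Subfield K, L < M → z ∈ M) : Algebra.adjoin L {z} = ⊤ := by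
  have hint := fun x => L.isIntegral_of_pow_mem hp.out.ne_zero (hL x)
  refine eq_top_iff.2 fun x _ => ?_
  by_cases hx : x ∈ L
  · exact Subalgebra.algebraMap_mem _ (⟨x, hx⟩ : L)
  have hzx : z ∈ IntermediateField.adjoin L {x} := by
    refine hM (IntermediateField.adjoin L {x}).toSubfield ?_
    refine SetLike.lt_iff_le_and_exists.2 ⟨fun y hy =>
      (IntermediateField.adjoin L {x}).algebraMap_mem ⟨y, hy⟩, x,
      IntermediateField.mem_adjoin_simple_self L x, hx⟩
  have hle : IntermediateField.adjoin L {z} ≤ IntermediateField.adjoin L {x} := by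
    rwa [IntermediateField.adjoin_simple_le_iff]
  have hfd : FiniteDimensional L (IntermediateField.adjoin L {x}) :=
    IntermediateField.adjoin.finiteDimensional (hint x)
  have heq := IntermediateField.eq_of_le_of_finrank_eq hle
    ((L.finrank_adjoin_simple_of_pow_mem p (hL z) hz).trans
      (L.finrank_adjoin_simple_of_pow_mem p (hL x) hx).symm)
  have := IntermediateField.mem_adjoin_simple_self L x
  rwa [← heq, ← IntermediateField.mem_toSubalgebra,
    IntermediateField.adjoin_simple_toSubalgebra_of_isAlgebraic (hint z).isAlgebraic] at this

theorem KaehlerDifferential.subsingleton_of_adjoin_singleton_eq_top {R A : Type*} [CommRing R]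
    [CommRing A] [Algebra R A] {z : A} (hz : Algebra.adjoin R {z} = ⊤)
    (hD : KaehlerDifferential.D R A z = 0) : Subsingleton (Ω[A⁄R]) := by
  have hD0 : KaehlerDifferential.D R A = 0 := by
    refine Derivation.ext_of_adjoin_eq_top {z} hz ?_
    rintro x rfl
    simpa using hD
  refine subsingleton_of_forall_eq 0 fun ω => ?_
  have hω : ω ∈ Submodule.span A (Set.range (KaehlerDifferential.D R A)) := by
    rw [KaehlerDifferential.span_range_derivation]; trivial
  have hr : Set.range (KaehlerDifferential.D R A) ⊆ {0} := by
    rintro _ ⟨x, rfl⟩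
    rw [hD0]
    rfl
  simpa using Submodule.span_mono hr hω

theorem KaehlerDifferential.D_ne_zero_of_maximal_subfield {K : Type*} [Field K] (p : ℕ)
    [hp : Fact p.Prime] [CharP K p] (L : Subfield K) (hL : ∀ x : K, x ^ p ∈ L) (z : K)
    (hz : z ∉ L) (hM : ∀ M : Subfield K, L < M → z ∈ M) :
    KaehlerDifferential.D L K z ≠ 0 := by
  intro hD
  have htop := L.adjoin_singleton_eq_top_of_maximal p hL z hz hM
  have hunr : Algebra.FormallyUnramified L K := ⟨subsingleton_of_adjoin_singleton_eq_top htop hD⟩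
  have hft : Algebra.FiniteType L K := ⟨⟨{z}, by rwa [Finset.coe_singleton]⟩⟩
  have hpi : IsPurelyInseparable L K := by
    rw [isPurelyInseparable_iff_pow_mem L p]
    exact fun x => ⟨1, ⟨x ^ p, hL x⟩, by rw [pow_one]; rfl⟩
  have hr := Algebra.FormallyUnramified.range_eq_top_of_isPurelyInseparable (K := L) (L := K)
  obtain ⟨x, hx⟩ : z ∈ (algebraMap L K).range := hr ▸ Subring.mem_top z
  exact hz (hx ▸ x.2)

/-- Differentials of elements of a subfield `L` containing all `p`-th powers do not span the
differential of an element outside `L`. -/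
theorem KaehlerDifferential.D_notMem_span_of_notMem_subfield {K : Type*} [Field K] (p : ℕ)
    [Fact p.Prime] [CharP K p] (L : Subfield K) (hL : ∀ x : K, x ^ p ∈ L) (z : K)
    (hz : z ∉ L) :
    KaehlerDifferential.D ℤ K z ∉ Submodule.span K (KaehlerDifferential.D ℤ K '' (L : Set K)) := by
  obtain ⟨M, hLM, hM⟩ := zorn_le_nonempty₀ {M : Subfield K | z ∉ M} (by
    intro c hc hchain M hMc
    have hdir : DirectedOn (· ≤ ·) c := hchain.directedOn
    refine ⟨sSup c, ?_, fun N hN => le_sSup hN⟩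
    intro h
    obtain ⟨N, hN, hzN⟩ := (Subfield.mem_sSup_of_directedOn ⟨M, hMc⟩ hdir).1 h
    exact hc hN hzN) L hz
  have hne := D_ne_zero_of_maximal_subfield p M (fun x => hLM (hL x)) z hM.prop (by
    intro N hN
    by_contra hzN
    exact hN.not_ge (hM.le_of_ge hzN hN.le))
  intro hmem
  refine hne ?_
  let g : Ω[K⁄ℤ] →ₗ[K] Ω[K⁄M] := KaehlerDifferential.map ℤ M K K
  have hg : ∀ x, g (D ℤ K x) = D M K x := fun x => by simp [g]
  have hle : Submodule.span K (KaehlerDifferential.D ℤ K '' (L : Set K)) ≤ LinearMap.ker g := by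
    rw [Submodule.span_le]
    rintro _ ⟨x, hx, rfl⟩
    rw [SetLike.mem_coe, LinearMap.mem_ker, hg]
    exact Derivation.map_algebraMap (D M K) (⟨x, hLM hx⟩ : M)
  rw [← hg]
  exact hle hmem

/-- Finitely many elements of a valuation ring lie in a subring generated by `p`-th powers and
finitely many elements with linearly independent differentials. -/
theorem Valuation.exists_mem_closure_pow_union_of_finite {K Γ₀ : Type*} [Field K]
    [LinearOrderedCommGroupWithZero Γ₀] (v : Valuation K Γ₀) (p : ℕ) [hp : Fact p.Prime] [CharP K p]
    (S : Set K) (hS : S.Finite) (hv : ∀ s ∈ S, v s ≤ 1) :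
    ∃ Z : Set K, LinearIndepOn K (KaehlerDifferential.D ℤ K) Z ∧ (∀ z ∈ Z, v z ≤ 1) ∧
      S ⊆ Subring.closure ({x | ∃ y, v y ≤ 1 ∧ y ^ p = x} ∪ Z) := by
  classical
  suffices H : ∃ L : Subfield K, (∀ x : K, x ^ p ∈ L) ∧ S ⊆ L ∧
      ∀ S' : Set K, S'.Finite → (∀ s ∈ S', s ∈ L ∧ v s ≤ 1) →
        ∃ Z : Set K, Z ⊆ L ∧ LinearIndepOn K (KaehlerDifferential.D ℤ K) Z ∧
          (∀ z ∈ Z, v z ≤ 1) ∧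
          S' ⊆ Subring.closure ({x | ∃ y, v y ≤ 1 ∧ y ^ p = x} ∪ Z) by
    obtain ⟨L, -, hSL, h⟩ := H
    obtain ⟨Z, -, hZ⟩ := h S hS fun s hs => ⟨hSL hs, hv s hs⟩
    exact ⟨Z, hZ⟩
  clear hv
  induction S, hS using Set.Finite.induction_on with
  | empty =>
    refine ⟨(frobenius K p).fieldRange, fun x => ⟨x, rfl⟩, Set.empty_subset _,
      fun S' _ hS' => ⟨∅, Set.empty_subset _, linearIndepOn_empty _ _, by simp, fun s hs => ?_⟩⟩
    obtain ⟨⟨x, rfl⟩, hx⟩ := hS' s hs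
    refine Subring.subset_closure (Or.inl ⟨x, ?_, rfl⟩)
    rw [frobenius_def, map_pow] at hx
    exact (pow_le_one_iff hp.out.ne_zero).1 hx
  | @insert y S _ _ ih =>
    obtain ⟨L, hL, hSL, h⟩ := ih
    by_cases hy : y ∈ L
    · exact ⟨L, hL, Set.insert_subset hy hSL, h⟩
    have hLm : ∀ x ∈ L, x ∈ IntermediateField.adjoin L {y} := fun x hx =>
      (IntermediateField.adjoin L {y}).algebraMap_mem ⟨x, hx⟩
    refine ⟨(IntermediateField.adjoin L {y}).toSubfield, fun x => hLm _ (hL x),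
      Set.insert_subset (IntermediateField.mem_adjoin_simple_self L y) fun s hs => hLm s (hSL hs),
      fun S' hS' hS'L => ?_⟩
    obtain ⟨z, hzL, hzy, hvz, T, hT, hTL, hS'T⟩ := exists_integral_generator_of_finite v p L y hy
      (hL y) S' hS' (fun s hs => (hS'L s hs).1) (fun s hs => (hS'L s hs).2)
    obtain ⟨Z, hZL, hZi, hZv, hTZ⟩ := h T hT hTL
    refine ⟨insert z Z, Set.insert_subset hzy fun s hs => hLm s (hZL hs), ?_, ?_, fun s hs => ?_⟩
    · refine hZi.insert fun hmem => ?_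
      exact KaehlerDifferential.D_notMem_span_of_notMem_subfield p L hL z hzL
        (Submodule.span_mono (Set.image_mono hZL) hmem)
    · rintro x (rfl | hx)
      exacts [hvz, hZv x hx]
    · refine (Subring.closure_le.2 ?_ : Subring.closure (T ∪ {z}) ≤ _) (hS'T s hs)
      refine Set.union_subset (hTZ.trans ?_) ?_
      · exact Subring.closure_mono (Set.union_subset_union_right _ (Set.subset_insert _ _))
      · rintro x rfl
        exact Subring.subset_closure (Or.inr (Or.inl rfl))

/-- The differentials of a valuation ring of characteristic `p` embed into those of its field of
fractions. -/
theorem ValuationRing.kaehlerDifferential_map_injective (p : ℕ) [hp : Fact p.Prime]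
    (O : Type*) [CommRing O] [IsDomain O] [ValuationRing O]
    (K : Type*) [Field K] [CharP K p] [Algebra O K] [IsFractionRing O K] :
    Function.Injective (KaehlerDifferential.map ℤ ℤ O K) := by
  classical
  rw [injective_iff_map_eq_zero]
  intro ω hω
  have hinj : Function.Injective (algebraMap O K) := IsFractionRing.injective O K
  have hpO : (p : O) = 0 := hinj (by simp)
  have hmem : ω ∈ Submodule.span O (Set.range (D ℤ O)) := by
    rw [KaehlerDifferential.span_range_derivation]; trivial
  obtain ⟨F, hF, hωF⟩ := Submodule.mem_span_finite_of_mem_span hmem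
  obtain ⟨Y, rfl⟩ : ∃ Y : Finset O, F = Y.image (D ℤ O) := by
    obtain ⟨Y, -, hY⟩ := Finset.subset_set_image_iff.1 (by simpa using hF :
      (F : Set _) ⊆ D ℤ O '' Set.univ)
    exact ⟨Y, hY.symm⟩
  obtain ⟨Z, hZi, hZv, hYZ⟩ := (valuation O K).exists_mem_closure_pow_union_of_finite p
    (algebraMap O K '' Y) (Y.finite_toSet.image _) (by
      rintro _ ⟨y, -, rfl⟩
      exact (mem_integer_iff O K _).2 ⟨y, rfl⟩)
  have hlift : ∀ x : K, valuation O K x ≤ 1 → ∃ a : O, algebraMap O K a = x :=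
    fun x hx => (mem_integer_iff O K x).1 hx
  choose! lft hlft using hlift
  let N : Submodule O (Ω[O⁄ℤ]) := Submodule.span O ((fun x => D ℤ O (lft x)) '' Z)
  let E : Subring O :=
    { carrier := {y | D ℤ O y ∈ N}
      mul_mem' := fun {a b} ha hb => by
        simp only [Set.mem_ofPred_eq] at *
        rw [Derivation.leibniz]
        exact N.add_mem (N.smul_mem _ hb) (N.smul_mem _ ha)
      one_mem' := by simp
      add_mem' := fun {a b} ha hb => by
        simp only [Set.mem_ofPred_eq] at *
        rw [map_add]; exact N.add_mem ha hb
      zero_mem' := by simp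
      neg_mem' := fun {a} ha => by
        simp only [Set.mem_ofPred_eq] at *
        rw [map_neg]; exact N.neg_mem ha }
  have hE : Subring.closure ({x | ∃ y, valuation O K y ≤ 1 ∧ y ^ p = x} ∪ Z) ≤
      E.map (algebraMap O K) := by
    rw [Subring.closure_le]
    rintro x (⟨y, hy, rfl⟩ | hx)
    · refine ⟨lft y ^ p, ?_, by rw [map_pow, hlft y hy]⟩
      change D ℤ O _ ∈ N
      rw [Derivation.leibniz_pow, ← Nat.cast_smul_eq_nsmul O, hpO, zero_smul]
      exact N.zero_mem
    · exact ⟨lft x, Submodule.subset_span ⟨x, hx, rfl⟩, hlft x (hZv x hx)⟩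
  have hωN : ω ∈ N := by
    refine (Submodule.span_le.2 ?_) hωF
    intro η hη
    obtain ⟨y, hy, rfl⟩ : ∃ y ∈ Y, D ℤ O y = η := by simpa using hη
    obtain ⟨y', hy', h⟩ := hE (hYZ ⟨y, hy, rfl⟩)
    rw [← hinj h]
    exact hy'
  obtain ⟨c, hcZ, rfl⟩ := (Finsupp.mem_span_image_iff_linearCombination O).1 hωN
  suffices c = 0 by rw [this, map_zero]
  let c' : K →₀ K := c.mapRange (algebraMap O K) (map_zero _)
  have hc' : Finsupp.linearCombination K (D ℤ K) c' = 0 := by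
    rw [← hω, Finsupp.linearCombination_apply, Finsupp.linearCombination_apply, map_finsuppSum,
      Finsupp.sum_mapRange_index (by simp)]
    refine Finsupp.sum_congr fun x hx => ?_
    rw [map_smul, KaehlerDifferential.map_D, hlft x (hZv x (hcZ hx)), algebraMap_smul]
  have hc'0 : c' = 0 := by
    refine linearIndepOn_iff.1 hZi c' ?_ hc'
    rw [Finsupp.mem_supported] at hcZ ⊢
    exact (Finset.coe_subset.2 Finsupp.support_mapRange).trans hcZ
  ext x
  refine hinj ?_
  have := DFunLike.congr_fun hc'0 x
  simpa [c'] using this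

theorem stmt4 (p : ℕ) (hp : p.Prime)
    (C : Type*) [Field C] [CharP C p]
    (O : Type*) [CommRing O] [IsDomain O] [ValuationRing O] [Algebra C O]
    (K : Type*) [Field K] [Algebra O K] [IsFractionRing O K]
    [Algebra C K] [IsScalarTower C O K]
    (ι : (ResidueField O ⊗[C] Ω[C⁄ℤ]) →ₗ[ResidueField O] (ResidueField O ⊗[O] Ω[O⁄ℤ]))
    (hι : ∀ (x : ResidueField O) (c : C),
      ι (x ⊗ₜ KaehlerDifferential.D ℤ C c) = x ⊗ₜ KaehlerDifferential.D ℤ O (algebraMap C O c))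
    (hinj : Function.Injective ι) :
    Function.Injective (KaehlerDifferential.mapBaseChange ℤ C K) := by
  classical
  have hpf : Fact p.Prime := ⟨hp⟩
  have hK : CharP K p := charP_of_injective_algebraMap (algebraMap C K).injective p
  have hmap : ∀ (x : ResidueField O) (w : Ω[C⁄ℤ]),
      ι (x ⊗ₜ w) = x ⊗ₜ KaehlerDifferential.map ℤ ℤ C O w := by
    intro x w
    have hw : w ∈ Submodule.span C (Set.range (D ℤ C)) := by
      rw [KaehlerDifferential.span_range_derivation]; trivial
    induction hw using Submodule.span_induction generalizing x with
    | mem w hw =>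
      obtain ⟨c, rfl⟩ := hw
      rw [hι, KaehlerDifferential.map_D]
    | zero => simp
    | add w w' _ _ h h' => rw [tmul_add, map_add, h, h', map_add, tmul_add]
    | smul c w _ h =>
      rw [← smul_tmul, h, map_smul, ← algebraMap_smul O c x,
        ← algebraMap_smul O c (KaehlerDifferential.map ℤ ℤ C O w), smul_tmul]
  rw [injective_iff_map_eq_zero]
  intro ξ hξ
  by_contra hξ0
  let b := Module.Free.chooseBasis C (Ω[C⁄ℤ])
  let r := (b.baseChange K).repr ξ
  have hr0 : r ≠ 0 := by simpa [r] using hξ0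
  obtain ⟨i₀, hi₀, hmax⟩ := r.support.exists_max_image (fun i => ValuationRing.valuation O K (r i))
    (Finsupp.support_nonempty_iff.2 hr0)
  have hri : r i₀ ≠ 0 := Finsupp.mem_support_iff.1 hi₀
  have hlift : ∀ i, ∃ a : O, algebraMap O K a = (r i₀)⁻¹ * r i := by
    intro i
    rw [← ValuationRing.mem_integer_iff, Valuation.mem_integer_iff, map_mul, map_inv₀]
    by_cases hi : i ∈ r.support
    · refine (mul_le_mul_right (hmax i hi) _).trans ?_
      rw [inv_mul_cancel₀]
      simpa using hri
    · simp [Finsupp.notMem_support_iff.1 hi]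
  choose a ha using hlift
  have hξsum : ξ = ∑ i ∈ r.support, r i ⊗ₜ[C] b i := by
    conv_lhs => rw [← (b.baseChange K).linearCombination_repr ξ]
    rw [Finsupp.linearCombination_apply, Finsupp.sum]
    simp [r, TensorProduct.smul_tmul']
  have hω : ∑ i ∈ r.support, a i • KaehlerDifferential.map ℤ ℤ C O (b i) = 0 := by
    apply ValuationRing.kaehlerDifferential_map_injective p O K
    rw [map_zero, map_sum]
    have h1 : ∀ w : Ω[C⁄ℤ], KaehlerDifferential.map ℤ ℤ O K (KaehlerDifferential.map ℤ ℤ C O w) =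
        KaehlerDifferential.map ℤ ℤ C K w := by
      intro w
      have hw : w ∈ Submodule.span C (Set.range (D ℤ C)) := by
        rw [KaehlerDifferential.span_range_derivation]; trivial
      induction hw using Submodule.span_induction with
      | mem w hw =>
        obtain ⟨c, rfl⟩ := hw
        simp only [KaehlerDifferential.map_D, ← IsScalarTower.algebraMap_apply]
      | zero => simp
      | add w w' _ _ h h' => simp only [map_add, h, h']
      | smul c w _ h =>
        rw [LinearMap.map_smul (KaehlerDifferential.map ℤ ℤ C O),
          LinearMap.map_smul (KaehlerDifferential.map ℤ ℤ C K),
          ← algebraMap_smul O c (KaehlerDifferential.map ℤ ℤ C O w), LinearMap.map_smul, h,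
          algebraMap_smul]
    have h2 : (r i₀)⁻¹ • KaehlerDifferential.mapBaseChange ℤ C K ξ = 0 := by rw [hξ, smul_zero]
    rw [hξsum, map_sum, Finset.smul_sum] at h2
    rw [← h2]
    refine Finset.sum_congr rfl fun i _ => ?_
    rw [map_smul, h1, KaehlerDifferential.mapBaseChange_tmul, smul_smul, ← ha, algebraMap_smul]
  have hzero : ∑ i ∈ r.support, residue O (a i) ⊗ₜ[C] b i = 0 := by
    apply hinj
    rw [map_zero, map_sum]
    simp only [hmap]
    have h3 := congrArg (fun w => (1 : ResidueField O) ⊗ₜ[O] w) hω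
    simp only [tmul_zero, tmul_sum] at h3
    rw [← h3]
    refine Finset.sum_congr rfl fun i _ => ?_
    rw [← smul_tmul, Algebra.smul_def, mul_one]
    rfl
  have hli := (b.baseChange (ResidueField O)).linearIndependent
  rw [linearIndependent_iff'] at hli
  have h4 := hli r.support (fun i => residue O (a i)) (by
    simpa [TensorProduct.smul_tmul'] using hzero) i₀ hi₀
  have h5 : a i₀ = 1 := by
    apply IsFractionRing.injective O K
    rw [ha, inv_mul_cancel₀ hri, map_one]
  simp only [h5, map_one] at h4
  exact one_ne_zero h4
end

section
/- Let p be a prime, C a field of characteristic p, and O a valuation ring containing C as a subring, with maximal ideal m and residue field k = O/m. If the canonical map ι : Ω_C ⊗_C k → Ω_O ⊗_O k is injective, then the kernel of the canonical map Ω_C ⊗_C k → Ω_k (induced by dc ⊗ x ↦ x·d(image of c in k)) has k-dimension at most 1. -/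
open TensorProduct KaehlerDifferential IsLocalRing

/-- In a valuation ring, the differentials of elements of the maximal ideal span a subspace of
dimension at most one in `k ⊗ Ω`. -/
theorem exists_forall_one_tmul_D_mem_span_singleton
    (O : Type*) [CommRing O] [IsDomain O] [ValuationRing O] :
    ∃ v : ResidueField O ⊗[O] Ω[O⁄ℤ], ∀ x ∈ maximalIdeal O,
      (1 : ResidueField O) ⊗ₜ[O] KaehlerDifferential.D ℤ O x ∈
        Submodule.span (ResidueField O) {v} := by
  have smul_one_eq_zero {a : O} (ha : a ∈ maximalIdeal O) : a • (1 : ResidueField O) = 0 := by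
    rw [Algebra.smul_def, mul_one]
    exact (residue_eq_zero_iff a).mpr ha
  have tmul_D_mul (a b : O) (ha : a ∈ maximalIdeal O) :
      (1 : ResidueField O) ⊗ₜ[O] KaehlerDifferential.D ℤ O (a * b) =
        residue O b • ((1 : ResidueField O) ⊗ₜ[O] KaehlerDifferential.D ℤ O a) := by
    rw [Derivation.leibniz, TensorProduct.tmul_add, ← TensorProduct.smul_tmul,
      smul_one_eq_zero ha, TensorProduct.zero_tmul, zero_add, TensorProduct.tmul_smul]
    rfl
  by_cases h : ∃ π ∈ maximalIdeal O, ∀ x ∈ maximalIdeal O, π ∣ x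
  · obtain ⟨π, hπ, hdvd⟩ := h
    refine ⟨1 ⊗ₜ KaehlerDifferential.D ℤ O π, fun x hx ↦ ?_⟩
    obtain ⟨b, rfl⟩ := hdvd x hx
    rw [tmul_D_mul π b hπ]
    exact Submodule.smul_mem _ _ (Submodule.mem_span_singleton_self _)
  · push Not at h
    refine ⟨0, fun x hx ↦ ?_⟩
    obtain ⟨y, hy, hxy⟩ := h x hx
    obtain ⟨z, rfl⟩ := (ValuationRing.dvd_total x y).resolve_left hxy
    have hz : z ∈ maximalIdeal O := by
      rw [mem_maximalIdeal, mem_nonunits_iff]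
      exact fun hu ↦ hxy (hu.mul_right_dvd.mpr dvd_rfl)
    rw [tmul_D_mul y z hy, (residue_eq_zero_iff z).mpr hz, zero_smul]
    exact Submodule.zero_mem _

/-- The kernel of `k ⊗ Ω_O → Ω_k` has dimension at most one for a valuation ring `O`. -/
theorem rank_ker_mapBaseChange_residueField_le_one
    (O : Type*) [CommRing O] [IsDomain O] [ValuationRing O] :
    Module.rank (ResidueField O)
      (LinearMap.ker (KaehlerDifferential.mapBaseChange ℤ O (ResidueField O))) ≤ 1 := by
  obtain ⟨v, hv⟩ := exists_forall_one_tmul_D_mem_span_singleton O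
  refine (Submodule.rank_mono fun w hw ↦ ?_).trans
    ((rank_span_le {v}).trans (Cardinal.mk_singleton v).le)
  obtain ⟨t, rfl⟩ := (KaehlerDifferential.exact_kerCotangentToTensor_mapBaseChange ℤ O
    (ResidueField O) residue_surjective w).mp hw
  obtain ⟨⟨x, hx⟩, rfl⟩ := Ideal.toCotangent_surjective _ t
  rw [KaehlerDifferential.kerCotangentToTensor_toCotangent]
  exact hv x ((residue_eq_zero_iff x).mp hx)

theorem stmt6 (p : ℕ) (hp : p.Prime)
    (C : Type*) [Field C] [CharP C p]
    (O : Type*) [CommRing O] [IsDomain O] [ValuationRing O] [Algebra C O]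
    (ι : (ResidueField O ⊗[C] Ω[C⁄ℤ]) →ₗ[ResidueField O] (ResidueField O ⊗[O] Ω[O⁄ℤ]))
    (hι : ∀ (x : ResidueField O) (c : C),
      ι (x ⊗ₜ KaehlerDifferential.D ℤ C c) = x ⊗ₜ KaehlerDifferential.D ℤ O (algebraMap C O c))
    (hinj : Function.Injective ι) :
    Module.rank (ResidueField O)
      (LinearMap.ker (KaehlerDifferential.mapBaseChange ℤ C (ResidueField O))) ≤ 1 := by
  have comm (z : ResidueField O ⊗[C] Ω[C⁄ℤ]) :
      KaehlerDifferential.mapBaseChange ℤ O (ResidueField O) (ι z) =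
        KaehlerDifferential.mapBaseChange ℤ C (ResidueField O) z := by
    induction z with
    | zero => simp
    | add a b ha hb => simp only [map_add, ha, hb]
    | tmul x ω =>
      have hω : ω ∈ Submodule.span C (Set.range (KaehlerDifferential.D ℤ C)) := by
        rw [KaehlerDifferential.span_range_derivation]
        trivial
      induction hω using Submodule.span_induction generalizing x with
      | mem _ h =>
        obtain ⟨c, rfl⟩ := h
        rw [hι, KaehlerDifferential.mapBaseChange_tmul, KaehlerDifferential.mapBaseChange_tmul,
          KaehlerDifferential.map_D, KaehlerDifferential.map_D,
          ← IsScalarTower.algebraMap_apply]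
      | zero => simp
      | add a b _ _ ha hb => simp only [TensorProduct.tmul_add, map_add, ha, hb]
      | smul c a _ ha => rw [← TensorProduct.smul_tmul, ha]
  have hmem : ∀ z ∈ LinearMap.ker (KaehlerDifferential.mapBaseChange ℤ C (ResidueField O)),
      ι z ∈ LinearMap.ker (KaehlerDifferential.mapBaseChange ℤ O (ResidueField O)) :=
    fun z hz ↦ LinearMap.mem_ker.mpr ((comm z).trans hz)
  have hrank := LinearMap.lift_rank_le_of_injective (ι.restrict hmem)
    fun a b hab ↦ Subtype.ext (hinj (congrArg Subtype.val hab))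
  rw [← Cardinal.lift_le_one_iff]
  exact hrank.trans
    (Cardinal.lift_le_one_iff.mpr (rank_ker_mapBaseChange_residueField_le_one O))
end

section
/- Let p be a prime and R an integral domain of characteristic p that is a finitely generated algebra over a field and is integrally closed in its fraction field (i.e. R is normal). Let t_1, …, t_n ∈ R be elements whose differentials dt_1, …, dt_n are linearly independent in Ω_{Frac(R)} over Frac(R). Then the set of height-one prime ideals 𝔭 of R for which the images dt_1 ⊗ 1, …, dt_n ⊗ 1 in Ω_{R_𝔭} ⊗_{R_𝔭} κ(𝔭) are linearly dependent over the residue field κ(𝔭) is finite. -/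
open TensorProduct KaehlerDifferential IsLocalRing

/-- The residues `dt₁ ⊗ 1, …, dtₙ ⊗ 1` in `Ω_{R_𝔭} ⊗_{R_𝔭} κ(𝔭)` are linearly
dependent over the residue field `κ(𝔭)` of the localization `R_𝔭`. -/
def DiffDependentAt {R : Type*} [CommRing R] {n : ℕ} (t : Fin n → R)
    (𝔭 : Ideal R) [𝔭.IsPrime] : Prop :=
  ¬ LinearIndependent (ResidueField (Localization.AtPrime 𝔭))
      (fun i : Fin n =>
        ((1 : ResidueField (Localization.AtPrime 𝔭)) ⊗ₜ[Localization.AtPrime 𝔭]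
          KaehlerDifferential.D ℤ (Localization.AtPrime 𝔭)
            (algebraMap R (Localization.AtPrime 𝔭) (t i)) :
          ResidueField (Localization.AtPrime 𝔭) ⊗[Localization.AtPrime 𝔭]
            Ω[(Localization.AtPrime 𝔭)⁄ℤ]))

/-- A derivation of a field agrees on any finite set with one whose values lie in the span of
its values on that set. -/
lemma Derivation.exists_eqOn_forall_mem_span {F M : Type*} [Field F] [AddCommGroup M] [Module F M]
    (δ : Derivation ℤ F M) (C : Set F) :
    ∃ δ' : Derivation ℤ F M, (∀ c ∈ C, δ' c = δ c) ∧ ∀ a, δ' a ∈ Submodule.span F (δ '' C) := by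
  let W : Submodule F (Ω[F⁄ℤ]) := Submodule.span F (KaehlerDifferential.D ℤ F '' C)
  obtain ⟨π, hπ⟩ := W.subtype.exists_leftInverse_of_injective W.ker_subtype
  have hmap : W.map δ.liftKaehlerDifferential = Submodule.span F (δ '' C) := by
    rw [Submodule.map_span, Set.image_image]
    simp
  refine ⟨(δ.liftKaehlerDifferential ∘ₗ W.subtype ∘ₗ π).compDer (KaehlerDifferential.D ℤ F),
    fun c hc ↦ ?_, fun a ↦ ?_⟩
  · have h : π (KaehlerDifferential.D ℤ F c) = ⟨_, Submodule.subset_span ⟨c, hc, rfl⟩⟩ :=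
      LinearMap.congr_fun hπ (⟨_, Submodule.subset_span ⟨c, hc, rfl⟩⟩ : W)
    simp [h]
  · rw [← hmap]
    exact ⟨_, (π (KaehlerDifferential.D ℤ F a)).2, rfl⟩

/-- The ring homomorphism to the dual numbers attached to a derivation. -/
noncomputable def Derivation.toDualNumberHom {A K : Type*} [CommRing A] [CommRing K] [Algebra A K]
    (d : Derivation ℤ A K) : A →+* DualNumber K where
  toFun a := (algebraMap A K a, d a)
  map_one' := by ext <;> simp [TrivSqZeroExt.fst, TrivSqZeroExt.snd] <;> rfl
  map_zero' := by ext <;> simp [TrivSqZeroExt.fst, TrivSqZeroExt.snd] <;> rfl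
  map_add' a b := by
    ext
    · exact map_add (algebraMap A K) a b
    · exact map_add d a b
  map_mul' a b := by
    ext
    · exact map_mul (algebraMap A K) a b
    · change d (a * b) = algebraMap A K a * d b + d a * algebraMap A K b
      rw [d.leibniz, Algebra.smul_def, Algebra.smul_def, mul_comm (d a)]

@[simp] lemma Derivation.fst_toDualNumberHom {A K : Type*} [CommRing A] [CommRing K] [Algebra A K]
    (d : Derivation ℤ A K) (a : A) : (d.toDualNumberHom a).fst = algebraMap A K a := rfl

@[simp] lemma Derivation.snd_toDualNumberHom {A K : Type*} [CommRing A] [CommRing K] [Algebra A K]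
    (d : Derivation ℤ A K) (a : A) : (d.toDualNumberHom a).snd = d a := rfl

/-- The derivation attached to a ring homomorphism to the dual numbers. -/
noncomputable def Derivation.ofDualNumberHom {A K : Type*} [CommRing A] [CommRing K] [Algebra A K]
    (ψ : A →+* DualNumber K) (h : ∀ a, (ψ a).fst = algebraMap A K a) : Derivation ℤ A K :=
  Derivation.mk' (AddMonoidHom.toIntLinearMap
    { toFun := fun a ↦ (ψ a).snd, map_zero' := by simp, map_add' := by simp }) fun a b ↦ by
      change (ψ (a * b)).snd = a • (ψ b).snd + b • (ψ a).snd
      rw [map_mul, TrivSqZeroExt.snd_mul, h, h, Algebra.smul_def a, Algebra.smul_def b]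
      simp [mul_comm]

@[simp] lemma Derivation.ofDualNumberHom_apply {A K : Type*} [CommRing A] [CommRing K]
    [Algebra A K] (ψ : A →+* DualNumber K) (h : ∀ a, (ψ a).fst = algebraMap A K a) (a : A) :
    Derivation.ofDualNumberHom ψ h a = (ψ a).snd := rfl

lemma MvPolynomial.eval₂Hom_congr_of_coeffs {σ A B : Type*} [CommSemiring A] [CommSemiring B]
    {f g : A →+* B} {x : σ → B} {q : MvPolynomial σ A} (h : ∀ c ∈ q.coeffs, f c = g c) :
    eval₂Hom f x q = eval₂Hom g x q := by
  simp only [coe_eval₂Hom, eval₂_eq]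
  refine Finset.sum_congr rfl fun m hm ↦ ?_
  rw [h _ (coeff_mem_coeffs m (mem_support_iff.mp hm))]

/-- A derivation to the fraction field can be modified, without changing it on a given finite set,
so that its values have a common denominator. -/
lemma exists_derivation_clearing_denominators (F : Type*) {R K : Type*} [Field F] [CommRing R]
    [IsDomain R] [Algebra F R] [Algebra.FiniteType F R] [Field K] [Algebra R K]
    [IsFractionRing R K] (D : Derivation ℤ R K) (T : Set R) (hT : T.Finite) :
    ∃ g : R, g ≠ 0 ∧ ∃ E : Derivation ℤ R R,
      ∀ t ∈ T, algebraMap R K (E t) = algebraMap R K g * D t := by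
  classical
  let _ : Algebra F K := ((algebraMap R K).comp (algebraMap F R)).toAlgebra
  have : IsScalarTower F R K := IsScalarTower.of_algebraMap_eq fun _ ↦ rfl
  obtain ⟨m, φ, hφ⟩ := Algebra.FiniteType.iff_quotient_mvPolynomial''.mp
    (inferInstance : Algebra.FiniteType F R)
  obtain ⟨S, hS⟩ : (RingHom.ker φ).FG := IsNoetherian.noetherian _
  choose s hs using hφ
  let C : Finset F := (S ∪ hT.toFinset.image s).biUnion MvPolynomial.coeffs
  obtain ⟨δ, hδC, hδ⟩ := (D.compAlgebraMap F).exists_eqOn_forall_mem_span (C : Set F)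
  let x : Fin m → R := fun i ↦ φ (.X i)
  let ψ : MvPolynomial (Fin m) F →+* DualNumber K :=
    MvPolynomial.eval₂Hom δ.toDualNumberHom (fun i ↦ D.toDualNumberHom (x i))
  have hψ' : MvPolynomial.eval₂Hom (D.compAlgebraMap F).toDualNumberHom
      (fun i ↦ D.toDualNumberHom (x i)) = D.toDualNumberHom.comp φ.toRingHom := by
    refine MvPolynomial.ringHom_ext (fun a ↦ ?_) fun i ↦ by simp [x]
    have : φ (MvPolynomial.C a) = algebraMap F R a := φ.commutes a
    ext <;> simp [this, IsScalarTower.algebraMap_apply F R K]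
  have hψC (q) (hq : q ∈ S ∪ hT.toFinset.image s) : ψ q = D.toDualNumberHom (φ q) := by
    refine (MvPolynomial.eval₂Hom_congr_of_coeffs fun c hc ↦ ?_).trans (RingHom.congr_fun hψ' q)
    ext
    · simp
    · simpa using hδC c (Finset.mem_coe.mpr (Finset.mem_biUnion.mpr ⟨q, hq, hc⟩))
  have hker : RingHom.ker φ.toRingHom ≤ RingHom.ker ψ := by
    change RingHom.ker φ ≤ _
    rw [← hS, Ideal.span_le]
    intro q hq
    have : φ q = 0 := by
      have : q ∈ RingHom.ker φ := hS ▸ Ideal.subset_span hq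
      exact this
    change ψ q = 0
    rw [hψC q (Finset.mem_union_left _ hq), this, map_zero]
  let Ψ : R →+* DualNumber K := RingHom.liftOfRightInverse φ.toRingHom s hs ⟨ψ, hker⟩
  have hΨ (q) : Ψ (φ q) = ψ q :=
    RingHom.liftOfRightInverse_comp_apply φ.toRingHom s hs ⟨ψ, hker⟩ q
  have hfst (a : R) : (Ψ a).fst = algebraMap R K a := by
    have : (TrivSqZeroExt.fstHom K K K).toRingHom.comp ψ =
        (algebraMap R K).comp φ.toRingHom := by
      refine MvPolynomial.ringHom_ext (fun a ↦ ?_) fun i ↦ by simp [ψ, x]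
      have : φ (MvPolynomial.C a) = algebraMap F R a := φ.commutes a
      simp [ψ, this, IsScalarTower.algebraMap_apply F R K]
    rw [← hs a, hΨ]
    exact RingHom.congr_fun this _
  let D' : Derivation ℤ R K := Derivation.ofDualNumberHom Ψ hfst
  have hD'T (t) (ht : t ∈ T) : D' t = D t := by
    have : D' t = (Ψ (φ (s t))).snd := by rw [hs]; rfl
    rw [this, hΨ, hψC _ (Finset.mem_union_right _
      (Finset.mem_image_of_mem s (hT.mem_toFinset.mpr ht))), hs, D.snd_toDualNumberHom]
  have hD'F (a : F) : D' (algebraMap F R a) = δ a := by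
    have : D' (algebraMap F R a) = (Ψ (φ (MvPolynomial.C a))).snd := by
      rw [show φ (MvPolynomial.C a) = algebraMap F R a from φ.commutes a]; rfl
    rw [this, hΨ]
    simp [ψ]
  have hD'x (i) : D' (x i) = D (x i) := by
    have : D' (x i) = (Ψ (φ (.X i))).snd := rfl
    rw [this, hΨ]
    simp [ψ]
  obtain ⟨g, hg⟩ := IsLocalization.exist_integer_multiples_of_finset (nonZeroDivisors R)
    (C.image (fun c ↦ D (algebraMap F R c)) ∪ Finset.univ.image fun i ↦ D (x i))
  have hint (a : R) : ∃ b : R, algebraMap R K b = algebraMap R K g * D' a := by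
    let N : Submodule R K :=
      (LinearMap.range (Algebra.linearMap R K)).comap (LinearMap.mulLeft R (algebraMap R K g))
    have hF (a : F) : D' (algebraMap F R a) ∈ N := by
      have hle : Submodule.span F ((D.compAlgebraMap F) '' (C : Set F)) ≤ N.restrictScalars F := by
        rw [Submodule.span_le]
        rintro _ ⟨c, hc, rfl⟩
        obtain ⟨b, hb⟩ := hg _ (Finset.mem_union_left _ (Finset.mem_image_of_mem _ hc))
        exact ⟨b, hb.trans (Algebra.smul_def _ _)⟩
      rw [hD'F]
      exact hle (hδ a)
    have hX (i) : D' (x i) ∈ N := by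
      rw [hD'x]
      obtain ⟨b, hb⟩ := hg _ (Finset.mem_union_right _
        (Finset.mem_image_of_mem (fun i ↦ D (x i)) (Finset.mem_univ i)))
      exact ⟨b, hb.trans (Algebra.smul_def _ _)⟩
    have hN (q) : D' (φ q) ∈ N := by
      induction q using MvPolynomial.induction_on with
      | C a =>
        rw [show φ (MvPolynomial.C a) = algebraMap F R a from φ.commutes a]
        exact hF a
      | add q r hq hr =>
        rw [map_add, map_add]
        exact N.add_mem hq hr
      | mul_X q i hq =>
        rw [map_mul, D'.leibniz]
        exact N.add_mem (N.smul_mem _ (hX i)) (N.smul_mem _ hq)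
    obtain ⟨b, hb⟩ := hN (s a)
    rw [hs] at hb
    exact ⟨b, hb⟩
  choose e he using hint
  have hinj : Function.Injective (algebraMap R K) := IsFractionRing.injective R K
  let E : Derivation ℤ R R := Derivation.mk' (AddMonoidHom.toIntLinearMap
    (AddMonoidHom.mk' e fun a b ↦ hinj (by simp [he, mul_add]))) fun a b ↦ hinj (by
      change algebraMap R K (e (a * b)) = algebraMap R K (a • e b + b • e a)
      simp only [he, D'.leibniz, map_add, map_mul, smul_eq_mul, Algebra.smul_def]
      ring)
  refine ⟨g, nonZeroDivisors.ne_zero g.2, E, fun t ht ↦ ?_⟩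
  rw [← hD'T t ht]
  exact he t

/-- A linearly independent family in a vector space has a dual family of linear functionals. -/
lemma LinearIndependent.exists_dual {ι K V : Type*} [DecidableEq ι] [Field K] [AddCommGroup V]
    [Module K V] {v : ι → V} (hv : LinearIndependent K v) (j : ι) :
    ∃ f : V →ₗ[K] K, ∀ i, f (v i) = if i = j then 1 else 0 := by
  obtain ⟨f, hf⟩ := (Finsupp.lapply (R := K) j ∘ₗ hv.repr).exists_extend
  refine ⟨f, fun i ↦ ?_⟩
  have h := LinearMap.congr_fun hf ⟨v i, Submodule.subset_span ⟨i, rfl⟩⟩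
  simp only [LinearMap.comp_apply, Submodule.subtype_apply] at h
  rw [h, hv.repr_eq_single i _ rfl]
  simp [Finsupp.single_apply]

/-- A derivation of `R` induces a linear functional on `Ω_{R_𝔭} ⊗ κ(𝔭)`. -/
lemma Derivation.exists_linearMap_residueField {R : Type*} [CommRing R] (E : Derivation ℤ R R)
    (𝔭 : Ideal R) [𝔭.IsPrime] :
    ∃ f : (ResidueField (Localization.AtPrime 𝔭) ⊗[Localization.AtPrime 𝔭]
        Ω[(Localization.AtPrime 𝔭)⁄ℤ]) →ₗ[ResidueField (Localization.AtPrime 𝔭)]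
          ResidueField (Localization.AtPrime 𝔭),
      ∀ t : R, f (1 ⊗ₜ KaehlerDifferential.D ℤ (Localization.AtPrime 𝔭)
        (algebraMap R (Localization.AtPrime 𝔭) t)) =
          algebraMap R (ResidueField (Localization.AtPrime 𝔭)) (E t) := by
  set A := Localization.AtPrime 𝔭
  let l : Ω[R⁄ℤ] →ₗ[R] A := Algebra.linearMap R A ∘ₗ E.liftKaehlerDifferential
  let ρ : Ω[R⁄ℤ] →ₗ[R] Ω[A⁄ℤ] := KaehlerDifferential.map ℤ ℤ R A
  have : IsLocalizedModule 𝔭.primeCompl ρ := inferInstance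
  let L : Ω[A⁄ℤ] →ₗ[A] A :=
    (IsLocalizedModule.lift 𝔭.primeCompl ρ l fun s ↦
      IsLocalizedModule.map_units (Algebra.linearMap R A) s).extendScalarsOfIsLocalization
        𝔭.primeCompl A
  refine ⟨(Algebra.linearMap A (ResidueField A) ∘ₗ L).liftBaseChange (ResidueField A),
    fun t ↦ ?_⟩
  have h : L (KaehlerDifferential.D ℤ A (algebraMap R A t)) = algebraMap R A (E t) := by
    have h := IsLocalizedModule.lift_apply 𝔭.primeCompl ρ l (fun s ↦
      IsLocalizedModule.map_units (Algebra.linearMap R A) s) (KaehlerDifferential.D ℤ R t)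
    rw [show ρ (KaehlerDifferential.D ℤ R t) = _ from KaehlerDifferential.map_D ℤ ℤ R A t] at h
    exact h.trans (by simp [l])
  rw [LinearMap.liftBaseChange_tmul, one_smul, LinearMap.comp_apply, h,
    IsScalarTower.algebraMap_apply R A (ResidueField A)]
  rfl

/-- Some nonzero element lies in every prime at which the differentials become dependent. -/
lemma exists_ne_zero_forall_mem_of_diffDependentAt (F : Type*) {R K : Type*} [Field F] [CommRing R]
    [IsDomain R] [Algebra F R] [Algebra.FiniteType F R] [Field K] [Algebra R K]
    [IsFractionRing R K] {n : ℕ} (t : Fin n → R)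
    (hK : LinearIndependent K
      (fun i ↦ KaehlerDifferential.D ℤ K (algebraMap R K (t i)))) :
    ∃ f : R, f ≠ 0 ∧ ∀ (𝔭 : Ideal R) [𝔭.IsPrime], DiffDependentAt t 𝔭 → f ∈ 𝔭 := by
  have hE (j : Fin n) : ∃ g : R, g ≠ 0 ∧ ∃ E : Derivation ℤ R R,
      ∀ i, E (t i) = if i = j then g else 0 := by
    obtain ⟨l, hl⟩ := hK.exists_dual j
    obtain ⟨g, hg, E, hE⟩ := exists_derivation_clearing_denominators F
      ((l.compDer (KaehlerDifferential.D ℤ K)).compAlgebraMap R) (Set.range t)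
      (Set.finite_range t)
    refine ⟨g, hg, E, fun i ↦ IsFractionRing.injective R K ?_⟩
    rw [hE _ ⟨i, rfl⟩]
    have : ((l.compDer (KaehlerDifferential.D ℤ K)).compAlgebraMap R) (t i) =
      if i = j then 1 else 0 := hl i
    rw [this]
    split_ifs <;> simp
  choose g hg E hE using hE
  refine ⟨∏ j, g j, Finset.prod_ne_zero_iff.mpr fun j _ ↦ hg j, fun 𝔭 h𝔭 hdep ↦ ?_⟩
  by_contra hmem
  refine hdep (Fintype.linearIndependent_iff.mpr fun c hc j ↦ ?_)
  obtain ⟨f, hf⟩ := (E j).exists_linearMap_residueField 𝔭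
  have hgj : g j ∉ 𝔭 := fun h ↦
    hmem (Ideal.mem_of_dvd 𝔭 (Finset.dvd_prod_of_mem g (Finset.mem_univ j)) h)
  have h := congrArg f hc
  simp only [map_sum, map_smul, hf, hE, map_zero] at h
  simpa [apply_ite, hgj] using h

theorem stmt9 (p : ℕ) (hp : p.Prime)
    (F : Type*) [Field F]
    (R : Type*) [CommRing R] [IsDomain R] [CharP R p] [Algebra F R]
    [Algebra.FiniteType F R] [IsIntegrallyClosed R]
    (K : Type*) [Field K] [Algebra R K] [IsFractionRing R K]
    (n : ℕ) (t : Fin n → R)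
    (hK : LinearIndependent K
      (fun i => KaehlerDifferential.D ℤ K (algebraMap R K (t i)))) :
    {𝔭 : Ideal R | ∃ h : 𝔭.IsPrime, 𝔭 ≠ ⊥ ∧
      (∀ q : Ideal R, q.IsPrime → q < 𝔭 → q = ⊥) ∧
      @DiffDependentAt R _ n t 𝔭 h}.Finite := by
  have : IsNoetherianRing R := Algebra.FiniteType.isNoetherianRing F R
  obtain ⟨f, hf0, hf⟩ := exists_ne_zero_forall_mem_of_diffDependentAt F t hK
  refine (Ideal.span {f}).finite_minimalPrimes_of_isNoetherianRing.subset ?_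
  rintro 𝔭 ⟨h𝔭, -, hmin, hdep⟩
  refine ⟨⟨h𝔭, by simpa [Ideal.span_le] using hf 𝔭 hdep⟩, fun q ⟨hq, hfq⟩ hle ↦ ?_⟩
  by_contra hne
  have hbot := hmin q hq (lt_of_le_not_ge hle hne)
  rw [hbot, Ideal.span_le] at hfq
  exact hf0 (by simpa using hfq)
end

section
/- Let K₀ be a pseudo-algebraically closed field and K/K₀ a finite separable field extension. Let R be a finitely generated K-algebra that is an integral domain such that R ⊗_K K̄ is an integral domain, where K̄ is an algebraic closure of K (equivalently, the quotient field of R is a regular extension of K). Let s ∈ R be an element not lying in (the image of) K. Then there exists a K-algebra homomorphism h : R → K such that h(s) is a primitive element of K over K₀, i.e. K₀(h(s)) = K. -/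
open TensorProduct

/-- A field `K₀` is pseudo-algebraically closed (PAC) if every finitely generated
integral domain `A` over `K₀` such that `A ⊗_{K₀} K̄₀` is an integral domain admits a
`K₀`-algebra homomorphism `A → K₀`. -/
def IsPseudoAlgebraicallyClosed (K₀ : Type u) [Field K₀] : Prop :=
  ∀ (A : Type u) [CommRing A] [IsDomain A] [Algebra K₀ A],
    Algebra.FiniteType K₀ A →
    IsDomain (A ⊗[K₀] AlgebraicClosure K₀) →
    Nonempty (A →ₐ[K₀] K₀)

theorem exists_algHom_apply_ne_zero {k A : Type*} [Field k] [IsAlgClosed k] [CommRing A]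
    [IsDomain A] [Algebra k A] [Algebra.FiniteType k A] {a : A} (ha : a ≠ 0) :
    ∃ χ : A →ₐ[k] k, χ a ≠ 0 := by
  have : Algebra.FiniteType A (Localization.Away a) :=
    IsLocalization.finiteType_of_monoid_fg (Submonoid.powers a) _
  have : Algebra.FiniteType k (Localization.Away a) := Algebra.FiniteType.trans (S := A) ‹_› ‹_›
  have : Nontrivial (Localization.Away a) :=
    (IsLocalization.injective (Localization.Away a)
      (powers_le_nonZeroDivisors_of_noZeroDivisors ha)).nontrivial
  obtain ⟨m, hm⟩ := Ideal.exists_maximal (Localization.Away a)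
  let _ : Field (Localization.Away a ⧸ m) := Ideal.Quotient.field m
  have : Module.Finite k (Localization.Away a ⧸ m) := finite_of_finite_type_of_isJacobsonRing _ _
  let χ : A →ₐ[k] k := (IsAlgClosed.lift (R := k) (S := Localization.Away a ⧸ m)).comp
    ((Ideal.Quotient.mkₐ k m).comp (IsScalarTower.toAlgHom k A (Localization.Away a)))
  exact ⟨χ, ((IsLocalization.Away.algebraMap_isUnit (S := Localization.Away a) a).map
    ((IsAlgClosed.lift (R := k) (S := Localization.Away a ⧸ m)).comp
      (Ideal.Quotient.mkₐ k m))).ne_zero⟩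

theorem isDomain_tensorProduct_of_isAlgClosed {k A B : Type*} [Field k] [IsAlgClosed k]
    [CommRing A] [IsDomain A] [Algebra k A] [Algebra.FiniteType k A]
    [CommRing B] [IsDomain B] [Algebra k B] : IsDomain (A ⊗[k] B) := by
  classical
  let b := Module.Basis.ofVectorSpace k B
  have key (χ : A →ₐ[k] k) (x : A ⊗[k] B) (i) :
      b.coord i (Algebra.TensorProduct.lift ((Algebra.ofId k B).comp χ) (AlgHom.id k B)
        (fun _ _ ↦ Commute.all _ _) x) = χ (equivFinsuppOfBasisRight b x i) := by
    induction x with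
    | zero => simp
    | add x y hx hy => simp_all
    | tmul x y =>
      have : algebraMap k B (χ x) * y = χ x • y := (Algebra.smul_def _ _).symm
      simp [Algebra.ofId_apply, this, mul_comm]
  have hne {x : A ⊗[k] B} (hx : x ≠ 0) : ∃ i, equivFinsuppOfBasisRight b x i ≠ 0 := by
    by_contra! h
    exact hx ((equivFinsuppOfBasisRight b).injective (by ext i; simpa using h i))
  have : NoZeroDivisors (A ⊗[k] B) := by
    refine ⟨fun {x y} hxy ↦ ?_⟩
    by_contra! h
    obtain ⟨i, hi⟩ := hne h.1
    obtain ⟨j, hj⟩ := hne h.2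
    obtain ⟨χ, hχ⟩ := exists_algHom_apply_ne_zero (k := k) (mul_ne_zero hi hj)
    rw [map_mul, ← key, ← key] at hχ
    have h0 := congrArg (Algebra.TensorProduct.lift ((Algebra.ofId k B).comp χ) (AlgHom.id k B)
        (fun _ _ ↦ Commute.all _ _)) hxy
    rw [map_mul, map_zero, mul_eq_zero] at h0
    rcases h0 with h0 | h0 <;> simp [h0] at hχ
  exact NoZeroDivisors.to_isDomain _

/-- Finite coproducts of integral domains of finite type over an algebraically closed field are
integral domains. -/
theorem exists_isDomain_coproduct {k : Type u} [Field k] [IsAlgClosed k] (ι : Type*) [Finite ι] :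
    ∀ (R : ι → Type u) [∀ i, CommRing (R i)] [∀ i, IsDomain (R i)] [∀ i, Algebra k (R i)]
    [∀ i, Algebra.FiniteType k (R i)],
    ∃ (S : Type u) (_ : CommRing S) (_ : IsDomain S) (_ : Algebra k S) (inj : ∀ i, R i →ₐ[k] S),
      ∀ (B : Type u) [CommRing B] [Algebra k B] (φ : ∀ i, R i →ₐ[k] B),
        ∃ ψ : S →ₐ[k] B, ∀ i, ψ.comp (inj i) = φ i := by
  induction ι using Finite.induction_empty_option with
  | of_equiv e ih =>
    intro R _ _ _ _
    obtain ⟨S, _, _, _, inj, h⟩ := ih (fun i ↦ R (e i))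
    refine ⟨S, inferInstance, inferInstance, inferInstance,
      e.piCongrLeft (fun i ↦ R i →ₐ[k] S) inj, fun B _ _ φ ↦ ?_⟩
    obtain ⟨ψ, hψ⟩ := h B fun i ↦ φ (e i)
    refine ⟨ψ, fun i ↦ ?_⟩
    obtain ⟨i, rfl⟩ := e.surjective i
    rw [Equiv.piCongrLeft_apply_apply, hψ]
  | h_empty =>
    intro R _ _ _ _
    exact ⟨k, inferInstance, inferInstance, inferInstance, fun i ↦ i.elim, fun B _ _ φ ↦
      ⟨Algebra.ofId k B, fun i ↦ i.elim⟩⟩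
  | h_option ih =>
    intro R _ _ _ _
    obtain ⟨S, _, _, _, inj, h⟩ := ih (fun i ↦ R (some i))
    refine ⟨R none ⊗[k] S, inferInstance, isDomain_tensorProduct_of_isAlgClosed, inferInstance,
      fun | none => Algebra.TensorProduct.includeLeft
          | some i => Algebra.TensorProduct.includeRight.comp (inj i), fun B _ _ φ ↦ ?_⟩
    obtain ⟨ψ, hψ⟩ := h B fun i ↦ φ (some i)
    refine ⟨Algebra.TensorProduct.lift (φ none) ψ fun _ _ ↦ Commute.all _ _, ?_⟩
    rintro (_ | i)
    · ext; simp
    · rw [← hψ]; ext; simp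

section evalTensor

variable {K₀ Ω K A B : Type*} [Field K₀] [Field Ω] [Algebra K₀ Ω] [Field K] [Algebra K₀ K]
  [CommRing A] [Algebra K₀ A] [CommRing B] [Algebra K₀ B] [Algebra Ω B] [IsScalarTower K₀ Ω B]

/-- The ring homomorphism `K ⊗ A → B`, `x ⊗ a ↦ σ x * ψ a`. -/
noncomputable def evalTensor (σ : K →ₐ[K₀] Ω) (ψ : A →ₐ[K₀] B) : K ⊗[K₀] A →ₐ[K₀] B :=
  Algebra.TensorProduct.lift ((IsScalarTower.toAlgHom K₀ Ω B).comp σ) ψ fun _ _ ↦ Commute.all _ _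

@[simp]
theorem evalTensor_tmul (σ : K →ₐ[K₀] Ω) (ψ : A →ₐ[K₀] B) (x : K) (a : A) :
    evalTensor σ ψ (x ⊗ₜ a) = algebraMap Ω B (σ x) * ψ a := by
  simp [evalTensor]

theorem evalTensor_eq_sum {ι : Type*} [Fintype ι] [DecidableEq ι] (e : Module.Basis ι K₀ K)
    (σ : K →ₐ[K₀] Ω) (ψ : A →ₐ[K₀] B) (x : K ⊗[K₀] A) :
    evalTensor σ ψ x = ∑ j, algebraMap Ω B (σ (e j)) * ψ (equivFinsuppOfBasisLeft e x j) := by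
  obtain ⟨c, rfl⟩ := (equivFinsuppOfBasisLeft e).symm.surjective x
  rw [LinearEquiv.apply_symm_apply, equivFinsuppOfBasisLeft_symm_apply,
    Finsupp.sum_fintype _ _ (by simp), map_sum]
  simp

theorem evalTensor_comp_map {A' : Type*} [CommRing A'] [Algebra K₀ A'] (σ : K →ₐ[K₀] Ω)
    (ψ : A →ₐ[K₀] B) (θ : A' →ₐ[K₀] A) (x : K ⊗[K₀] A') :
    evalTensor σ ψ (Algebra.TensorProduct.map (AlgHom.id K K) θ x) =
      evalTensor σ (ψ.comp θ) x := by
  induction x with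
  | zero => simp
  | add x y hx hy => simp_all
  | tmul x y => simp

theorem map_evalTensor {C : Type*} [CommRing C] [Algebra K₀ C] [Algebra Ω C]
    [IsScalarTower K₀ Ω C] (σ : K →ₐ[K₀] Ω) (ψ : A →ₐ[K₀] B) (θ : B →ₐ[Ω] C) (x : K ⊗[K₀] A) :
    θ (evalTensor σ ψ x) = evalTensor σ ((θ.restrictScalars K₀).comp ψ) x := by
  induction x with
  | zero => simp
  | add x y hx hy => simp_all
  | tmul x y => simp

theorem mulVec_coord_eq_evalTensor {ι : Type*} [Fintype ι] [DecidableEq ι]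
    (e : Module.Basis ι K₀ K) (σ : ι → K →ₐ[K₀] Ω) (ψ : A →ₐ[K₀] B) (x : K ⊗[K₀] A) :
    ((Matrix.of fun i j ↦ σ i (e j)).map (algebraMap Ω B)).mulVec
      (fun j ↦ ψ (equivFinsuppOfBasisLeft e x j)) = fun i ↦ evalTensor (σ i) ψ x := by
  ext i
  simp [Matrix.mulVec, dotProduct, evalTensor_eq_sum e]

end evalTensor

/-- Existence of the Weil restriction of a finitely generated `K`-algebra `R` along a finite
extension `K / K₀` which is split by `Ω`, with its universal property for `Ω`-algebras. -/
theorem exists_weilRestriction {K₀ : Type u} {Ω : Type*} [Field K₀] [Field Ω] [Algebra K₀ Ω]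
    {K : Type*} [Field K] [Algebra K₀ K] (R : Type*) [CommRing R] [Algebra K R]
    [Algebra.FiniteType K R] {ι : Type} [Fintype ι] [DecidableEq ι]
    (e : Module.Basis ι K₀ K) (σ : ι → K →ₐ[K₀] Ω)
    (hσ : IsUnit (Matrix.of fun i j ↦ σ i (e j))) :
    ∃ (A : Type u) (_ : CommRing A) (_ : Algebra K₀ A) (η : R →ₐ[K] K ⊗[K₀] A),
      Algebra.FiniteType K₀ A ∧
      (∀ (B : Type u) [CommRing B] [Algebra K₀ B] [Algebra Ω B] [IsScalarTower K₀ Ω B]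
        (φ : ι → R →+* B), (∀ i x, φ i (algebraMap K R x) = algebraMap Ω B (σ i x)) →
        ∃ ψ : A →ₐ[K₀] B, ∀ i r, evalTensor (σ i) ψ (η r) = φ i r) ∧
      (∀ (B : Type u) [CommRing B] [Algebra K₀ B] [Algebra Ω B] [IsScalarTower K₀ Ω B]
        (ψ ψ' : A →ₐ[K₀] B),
        (∀ i r, evalTensor (σ i) ψ (η r) = evalTensor (σ i) ψ' (η r)) → ψ = ψ') := by
  obtain ⟨m, π, hπ⟩ := Algebra.FiniteType.iff_quotient_mvPolynomial''.mp
    (inferInstance : Algebra.FiniteType K R)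
  let Φ : MvPolynomial (Fin m) K →ₐ[K] K ⊗[K₀] MvPolynomial (Fin m × ι) K₀ :=
    MvPolynomial.aeval fun j ↦ ∑ i, e i ⊗ₜ MvPolynomial.X (j, i)
  let J : Ideal (MvPolynomial (Fin m × ι) K₀) :=
    Ideal.span {a | ∃ f ∈ RingHom.ker π, ∃ i, equivFinsuppOfBasisLeft e (Φ f) i = a}
  let q := Ideal.Quotient.mkₐ K₀ J
  let Q : K ⊗[K₀] MvPolynomial (Fin m × ι) K₀ →ₐ[K]
    K ⊗[K₀] (MvPolynomial (Fin m × ι) K₀ ⧸ J) := Algebra.TensorProduct.map (AlgHom.id K K) q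
  have hcoord (x i) : equivFinsuppOfBasisLeft e (Q x) i = q (equivFinsuppOfBasisLeft e x i) := by
    induction x with
    | zero => simp
    | add x y hx hy => simp_all
    | tmul x y => simp [Q]
  have hker : ∀ f ∈ RingHom.ker π, (Q.comp Φ) f = 0 := by
    intro f hf
    refine (equivFinsuppOfBasisLeft e).injective (Finsupp.ext fun i ↦ ?_)
    rw [AlgHom.comp_apply, hcoord, map_zero, Finsupp.zero_apply]
    exact Ideal.Quotient.eq_zero_iff_mem.mpr (Ideal.subset_span ⟨f, hf, i, rfl⟩)
  let η : R →ₐ[K] K ⊗[K₀] (MvPolynomial (Fin m × ι) K₀ ⧸ J) :=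
    (Ideal.Quotient.liftₐ (RingHom.ker π) (Q.comp Φ) hker).comp
      (Ideal.quotientKerAlgEquivOfSurjective hπ).symm
  have hη (f) : η (π f) = Q (Φ f) := by
    have : (Ideal.quotientKerAlgEquivOfSurjective hπ).symm (π f) =
        Ideal.Quotient.mk (RingHom.ker π) f := by
      rw [AlgEquiv.symm_apply_eq]; rfl
    exact congrArg (Ideal.Quotient.liftₐ (RingHom.ker π) (Q.comp Φ) hker) this
  have hX (j i) : equivFinsuppOfBasisLeft e (η (π (.X j))) i = q (.X (j, i)) := by
    rw [hη, hcoord]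
    simp [Φ, Finsupp.single_apply]
  refine ⟨MvPolynomial (Fin m × ι) K₀ ⧸ J, inferInstance, inferInstance, η, inferInstance, ?_, ?_⟩
  · intro B _ _ _ _ φ hφ
    have hσB : IsUnit ((Matrix.of fun i j ↦ σ i (e j)).map (algebraMap Ω B)) :=
      hσ.map (algebraMap Ω B).mapMatrix
    choose c hc using fun j ↦ Matrix.mulVec_surjective_iff_isUnit.mpr hσB fun i ↦ φ i (π (.X j))
    let ψ₀ : MvPolynomial (Fin m × ι) K₀ →ₐ[K₀] B := MvPolynomial.aeval fun p ↦ c p.1 p.2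
    have hψ₀ (i f) : evalTensor (σ i) ψ₀ (Φ f) = φ i (π f) := by
      have : ((evalTensor (σ i) ψ₀).toRingHom.comp Φ.toRingHom) =
          (φ i).comp π.toRingHom := by
        refine MvPolynomial.ringHom_ext (fun x ↦ ?_) fun j ↦ ?_
        · simp [Φ, Algebra.TensorProduct.algebraMap_apply, hφ, ← MvPolynomial.algebraMap_eq]
        · simpa [Φ, ψ₀, Matrix.mulVec, dotProduct] using congrFun (hc j) i
      exact congr($this f)
    have hJ : ∀ a ∈ J, ψ₀ a = 0 := by
      intro a ha
      refine (Ideal.span_le (I := RingHom.ker ψ₀)).mpr ?_ ha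
      rintro _ ⟨f, hf, i, rfl⟩
      have h0 := mulVec_coord_eq_evalTensor e σ ψ₀ (Φ f)
      simp only [hψ₀, (RingHom.mem_ker).mp hf, map_zero] at h0
      exact congrFun (Matrix.mulVec_injective_of_isUnit hσB
        (h0.trans (Matrix.mulVec_zero _).symm)) i
    refine ⟨Ideal.Quotient.liftₐ J ψ₀ hJ, fun i r ↦ ?_⟩
    obtain ⟨f, rfl⟩ := hπ r
    rw [hη, ← hψ₀, evalTensor_comp_map]
    congr 2
  · intro B _ _ _ _ ψ ψ' h
    have hσB : IsUnit ((Matrix.of fun i j ↦ σ i (e j)).map (algebraMap Ω B)) :=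
      hσ.map (algebraMap Ω B).mapMatrix
    refine Ideal.Quotient.algHom_ext _ (MvPolynomial.algHom_ext fun ⟨j, i⟩ ↦ ?_)
    have := Matrix.mulVec_injective_of_isUnit hσB <|
      (mulVec_coord_eq_evalTensor e σ ψ (η (π (.X j)))).trans <|
      (funext fun i ↦ h i _).trans (mulVec_coord_eq_evalTensor e σ ψ' (η (π (.X j)))).symm
    simpa [hX, q] using congrFun this i

theorem one_tmul_notMem_range_algebraMap {K Ω R : Type*} [Field K] [Field Ω] [Algebra K Ω]
    [CommRing R] [Algebra K R] {s : R} (hs : s ∉ (algebraMap K R).range) :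
    (1 ⊗ₜ s : Ω ⊗[K] R) ∉ (algebraMap Ω (Ω ⊗[K] R)).range := by
  rintro ⟨c, hc⟩
  have hs' : s ∉ Submodule.span K {(1 : R)} := by
    intro h
    obtain ⟨a, rfl⟩ := Submodule.mem_span_singleton.mp h
    exact hs ⟨a, Algebra.algebraMap_eq_smul_one a⟩
  obtain ⟨f, hfs, hf⟩ := Submodule.exists_le_ker_of_notMem hs'
  have hf1 : f 1 = 0 := hf (Submodule.mem_span_singleton_self 1)
  have h := congrArg (TensorProduct.rid K Ω ∘ f.lTensor Ω) hc
  simp [Algebra.TensorProduct.algebraMap_apply, hf1] at h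
  exact hfs (by simpa using h.symm)

/-- The base change of a geometrically integral algebra `R` over `K` along an embedding of `K` into
an algebraic closure `Ω` of a subfield, realised in the universe of `Ω`. -/
theorem exists_isDomain_baseChange {K₀ : Type*} {Ω : Type u} [Field K₀] [Field Ω] [Algebra K₀ Ω]
    [IsAlgClosure K₀ Ω] {K : Type*} [Field K] [Algebra K₀ K]
    {R : Type*} [CommRing R] [Algebra K R] [Algebra.FiniteType K R]
    (hreg : IsDomain (R ⊗[K] AlgebraicClosure K)) (s : R) (hs : s ∉ (algebraMap K R).range)
    (σ : K →ₐ[K₀] Ω) :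
    ∃ (S : Type u) (_ : CommRing S) (_ : IsDomain S) (_ : Algebra Ω S) (j : R →+* S),
      Algebra.FiniteType Ω S ∧ (∀ x, j (algebraMap K R x) = algebraMap Ω S (σ x)) ∧
      j s ∉ (algebraMap Ω S).range ∧
      ∀ (B : Type u) [CommRing B] [Algebra Ω B] (φ : R →+* B),
        (∀ x, φ (algebraMap K R x) = algebraMap Ω B (σ x)) →
        ∃ ψ : S →ₐ[Ω] B, ∀ r, ψ (j r) = φ r := by
  let _ : Algebra K Ω := σ.toRingHom.toAlgebra
  have : IsScalarTower K₀ K Ω := .of_algebraMap_eq' σ.comp_algebraMap.symm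
  have : IsAlgClosed Ω := IsAlgClosure.isAlgClosed K₀
  have : Algebra.IsAlgebraic K₀ Ω := IsAlgClosure.isAlgebraic
  have : Algebra.IsAlgebraic K Ω := Algebra.IsAlgebraic.tower_top (K := K₀) K
  have : IsAlgClosure K Ω := ⟨inferInstance, inferInstance⟩
  have : IsDomain (Ω ⊗[K] R) :=
    ((Algebra.TensorProduct.congr (IsAlgClosure.equiv K Ω (AlgebraicClosure K))
      AlgEquiv.refl).trans (Algebra.TensorProduct.comm K _ _)).toMulEquiv.isDomain _
  have : Small.{u} (Ω ⊗[K] R) := Algebra.FiniteType.small (R := Ω)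
  let E : Shrink.{u} (Ω ⊗[K] R) ≃ₐ[Ω] Ω ⊗[K] R := Shrink.algEquiv Ω _
  refine ⟨Shrink.{u} (Ω ⊗[K] R), inferInstance, E.toMulEquiv.isDomain _, inferInstance,
    (E.symm : _ →+* _).comp (Algebra.TensorProduct.includeRight (R := K) (A := Ω)).toRingHom,
    .equiv inferInstance E.symm, fun x ↦ ?_, ?_, fun B _ _ φ hφ ↦ ?_⟩
  · have : (1 ⊗ₜ algebraMap K R x : Ω ⊗[K] R) = algebraMap Ω _ (σ x) :=
      (Algebra.TensorProduct.includeRight (R := K) (A := Ω)).commutes x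
    exact (congrArg E.symm this).trans (E.symm.commutes _)
  · rintro ⟨c, hc⟩
    refine one_tmul_notMem_range_algebraMap (Ω := Ω) hs ⟨c, ?_⟩
    simpa using congrArg E hc
  · let _ : Algebra K B := ((algebraMap Ω B).comp (algebraMap K Ω)).toAlgebra
    have : IsScalarTower K Ω B := .of_algebraMap_eq' rfl
    let φ' : R →ₐ[K] B := { φ with commutes' := hφ }
    refine ⟨(Algebra.TensorProduct.lift (Algebra.ofId Ω B) φ' fun _ _ ↦ Commute.all _ _).comp
      (E : _ →ₐ[Ω] _), fun r ↦ ?_⟩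
    simp [φ']

theorem isDomain_tensorProduct_localization_away {k A Ω : Type*} [Field k] [CommRing A]
    [Algebra k A] [Field Ω] [Algebra k Ω] [IsDomain (Ω ⊗[k] A)] {d : A} (hd : d ≠ 0) :
    IsDomain (Ω ⊗[k] Localization.Away d) := by
  let f : Ω ⊗[k] A →ₐ[Ω] Ω ⊗[k] Localization.Away d :=
    Algebra.TensorProduct.map (AlgHom.id Ω Ω) (IsScalarTower.toAlgHom k A _)
  let _ : Algebra (Ω ⊗[k] A) (Ω ⊗[k] Localization.Away d) := f.toRingHom.toAlgebra
  have : IsScalarTower Ω (Ω ⊗[k] A) (Ω ⊗[k] Localization.Away d) :=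
    .of_algebraMap_eq' f.comp_algebraMap.symm
  have := IsLocalization.tensorProduct_tensorProduct_right k Ω (Submonoid.powers d)
    (Localization.Away d) (by ext a; simp [RingHom.algebraMap_toAlgebra, f])
  refine IsLocalization.isDomain_of_le_nonZeroDivisors (R := Ω ⊗[k] A)
    (M := (Submonoid.powers d).map (Algebra.TensorProduct.includeRight (R := k) (A := Ω)))
    (Ω ⊗[k] Localization.Away d) ?_
  rw [Submonoid.map_powers]
  exact powers_le_nonZeroDivisors_of_noZeroDivisors fun h ↦ hd
    (Algebra.TensorProduct.includeRight_injective (algebraMap k Ω).injective (by simpa using h))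

/-- If the evaluations of `t : K ⊗ A` along the embeddings `σ i` are pairwise distinct at one
point of `A`, then they are pairwise distinct exactly where a certain element `d : A` does not
vanish. -/
theorem exists_ne_zero_iff_injective_evalTensor {K₀ Ω K A : Type*} [Field K₀] [Field Ω]
    [Algebra K₀ Ω] [Field K] [Algebra K₀ K] [CommRing A] [Algebra K₀ A] {n : ℕ}
    (e : Module.Basis (Fin n) K₀ K) (σ : Fin n → K →ₐ[K₀] Ω)
    (hσ : IsUnit (Matrix.of fun i j ↦ σ i (e j))) (t : K ⊗[K₀] A) :
    ∃ d : A, ∀ (B : Type u) [CommRing B] [IsDomain B] [Algebra K₀ B] [Algebra Ω B]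
      [IsScalarTower K₀ Ω B] (ψ : A →ₐ[K₀] B),
      ψ d ≠ 0 ↔ Function.Injective fun i ↦ evalTensor (σ i) ψ t := by
  let C : Matrix (Fin n) (Fin n) A := .of fun j k ↦ equivFinsuppOfBasisLeft e (t ^ (k : ℕ)) j
  refine ⟨C.det, fun B _ _ _ _ _ ψ ↦ ?_⟩
  have hσB : IsUnit ((Matrix.of fun i j ↦ σ i (e j)).map (algebraMap Ω B)) :=
    hσ.map (algebraMap Ω B).mapMatrix
  have hC : (Matrix.of fun i j ↦ σ i (e j)).map (algebraMap Ω B) * C.map ψ =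
      Matrix.vandermonde fun i ↦ evalTensor (σ i) ψ t := by
    ext i k
    rw [Matrix.vandermonde_apply, ← map_pow]
    exact congrFun (mulVec_coord_eq_evalTensor e σ ψ (t ^ (k : ℕ))) i
  rw [← Matrix.det_vandermonde_ne_zero_iff, ← hC, Matrix.det_mul, mul_ne_zero_iff,
    and_iff_right ((Matrix.isUnit_iff_isUnit_det _).mp hσB).ne_zero, AlgHom.map_det]
  rfl

/-- A finite separable extension has as many embeddings into an algebraically closed field as
its degree, and they are separated by a basis. -/
theorem exists_basis_isUnit_embeddings (K₀ K Ω : Type*) [Field K₀] [Field K] [Algebra K₀ K]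
    [FiniteDimensional K₀ K] [Algebra.IsSeparable K₀ K] [Field Ω] [Algebra K₀ Ω]
    [IsAlgClosed Ω] :
    ∃ (n : ℕ) (e : Module.Basis (Fin n) K₀ K) (σ : Fin n ≃ (K →ₐ[K₀] Ω)),
      IsUnit (Matrix.of fun i j ↦ σ i (e j)) := by
  let pb := Field.powerBasisOfFiniteOfSeparable K₀ K
  have hcard : Fintype.card (K →ₐ[K₀] Ω) = pb.dim := by rw [AlgHom.card, pb.finrank]
  let σ := (Fintype.equivFinOfCardEq hcard).symm
  refine ⟨pb.dim, pb.basis, σ, ?_⟩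
  have hM : (Matrix.of fun i j ↦ σ i (pb.basis j)) = Matrix.vandermonde fun i ↦ σ i pb.gen := by
    ext i j
    simp [Matrix.vandermonde_apply]
  rw [hM, Matrix.isUnit_iff_isUnit_det, isUnit_iff_ne_zero, Matrix.det_vandermonde_ne_zero_iff]
  exact fun i j h ↦ σ.injective (pb.algHom_ext h)

/-- The Weil restriction of a geometrically integral algebra `R` is geometrically integral, and for
non-constant `s : R` it has a point at which the conjugates of `s` are pairwise distinct. -/
theorem exists_geometricallyIntegral_weilRestriction {K₀ Ω : Type u} [Field K₀] [Field Ω]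
    [Algebra K₀ Ω] [IsAlgClosure K₀ Ω] {K : Type*} [Field K] [Algebra K₀ K]
    {R : Type*} [CommRing R] [Algebra K R] [Algebra.FiniteType K R]
    (hreg : IsDomain (R ⊗[K] AlgebraicClosure K)) (s : R) (hs : s ∉ (algebraMap K R).range)
    {n : ℕ} (e : Module.Basis (Fin n) K₀ K) (σ : Fin n → K →ₐ[K₀] Ω)
    (hσ : IsUnit (Matrix.of fun i j ↦ σ i (e j))) :
    ∃ (A : Type u) (_ : CommRing A) (_ : Algebra K₀ A) (η : R →ₐ[K] K ⊗[K₀] A),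
      Algebra.FiniteType K₀ A ∧ IsDomain (Ω ⊗[K₀] A) ∧
      ∃ (S : Type u) (_ : CommRing S) (_ : IsDomain S) (_ : Algebra K₀ S) (_ : Algebra Ω S)
        (_ : IsScalarTower K₀ Ω S) (ψ : A →ₐ[K₀] S),
        Function.Injective fun i ↦ evalTensor (σ i) ψ (η s) := by
  have : IsAlgClosed Ω := IsAlgClosure.isAlgClosed K₀
  obtain ⟨A, _, _, η, hA, hex, huniq⟩ := exists_weilRestriction (Ω := Ω) R e σ hσ
  choose T _ _ _ j hT hj hjs hlift using fun i ↦ exists_isDomain_baseChange hreg s hs (σ i)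
  obtain ⟨S, _, _, _, inj, hS⟩ := exists_isDomain_coproduct (k := Ω) (Fin n) T
  let _ : Algebra K₀ S := ((algebraMap Ω S).comp (algebraMap K₀ Ω)).toAlgebra
  have : IsScalarTower K₀ Ω S := .of_algebraMap_eq' rfl
  obtain ⟨ψ, hψ⟩ := hex S (fun i ↦ (inj i : T i →+* S).comp (j i)) fun i x ↦ by simp [hj]
  refine ⟨A, inferInstance, inferInstance, η, hA, ?_, S, inferInstance, inferInstance,
    inferInstance, inferInstance, inferInstance, ψ, ?_⟩
  · choose g hg using fun i ↦ hlift i (Ω ⊗[K₀] A)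
      ((evalTensor (σ i) Algebra.TensorProduct.includeRight : K ⊗[K₀] A →ₐ[K₀] _).toRingHom.comp
        η.toRingHom) fun x ↦ by simp [Algebra.TensorProduct.algebraMap_apply]
    obtain ⟨G, hG⟩ := hS (Ω ⊗[K₀] A) g
    let F : Ω ⊗[K₀] A →ₐ[Ω] S :=
      Algebra.TensorProduct.lift (Algebra.ofId Ω S) ψ fun _ _ ↦ Commute.all _ _
    have hGψ : (G.restrictScalars K₀).comp ψ = Algebra.TensorProduct.includeRight := by
      refine huniq (Ω ⊗[K₀] A) _ _ fun i r ↦ ?_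
      rw [← map_evalTensor, hψ]
      have := congr($(hG i) (j i r))
      simpa [hg] using this
    have hGF : G.comp F = AlgHom.id Ω _ := by
      refine Algebra.TensorProduct.ext (by ext) ?_
      ext a
      simpa [F] using congr($hGψ a)
    have hF : Function.Injective F :=
      Function.LeftInverse.injective (g := G) fun x ↦ congr($hGF x)
    exact hF.isDomain F.toRingHom
  · intro i i' h
    by_contra hne
    simp only [hψ] at h
    choose χ hχ using fun i ↦ exists_algHom_apply_ne_zero (k := Ω) (one_ne_zero (α := T i))
    obtain ⟨G, hG⟩ := hS (T i) <|
      Function.update (fun l ↦ (Algebra.ofId Ω (T i)).comp (χ l)) i (AlgHom.id Ω (T i))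
    have h1 := congr($(hG i) (j i s))
    have h2 := congr($(hG i') (j i' s))
    rw [Function.update_self] at h1
    rw [Function.update_of_ne (Ne.symm hne)] at h2
    refine hjs i ⟨χ i' (j i' s), ?_⟩
    exact (h2.symm.trans (congrArg G h.symm)).trans h1

theorem stmt12 (K₀ : Type u) [Field K₀] (hPAC : IsPseudoAlgebraicallyClosed K₀)
    (K : Type v) [Field K] [Algebra K₀ K] [FiniteDimensional K₀ K]
    [Algebra.IsSeparable K₀ K]
    (R : Type w) [CommRing R] [IsDomain R] [Algebra K R]
    (hft : Algebra.FiniteType K R)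
    (hreg : IsDomain (R ⊗[K] AlgebraicClosure K))
    (s : R) (hs : s ∉ (algebraMap K R).range) :
    ∃ h : R →ₐ[K] K, IntermediateField.adjoin K₀ {h s} = ⊤ := by
  obtain ⟨n, e, σ, hσ⟩ := exists_basis_isUnit_embeddings K₀ K (AlgebraicClosure K₀)
  obtain ⟨A, _, _, η, hA, hAdom, S, _, _, _, _, _, ψS, hψS⟩ :=
    exists_geometricallyIntegral_weilRestriction hreg s hs e σ hσ
  obtain ⟨d, hd⟩ := exists_ne_zero_iff_injective_evalTensor e σ hσ (η s)
  have hd0 : d ≠ 0 := fun h ↦ (hd S ψS).mpr hψS (by simp [h])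
  have := isDomain_tensorProduct_localization_away (k := K₀) (Ω := AlgebraicClosure K₀) hd0
  have : IsDomain (Localization.Away d ⊗[K₀] AlgebraicClosure K₀) :=
    (Algebra.TensorProduct.comm K₀ _ _).toMulEquiv.isDomain
      (AlgebraicClosure K₀ ⊗[K₀] Localization.Away d)
  have : IsDomain (Localization.Away d) :=
    (Algebra.TensorProduct.includeRight_injective (R := K₀) (A := AlgebraicClosure K₀)
      (B := Localization.Away d) (algebraMap K₀ _).injective).isDomain
      (Algebra.TensorProduct.includeRight (R := K₀) (A := AlgebraicClosure K₀)).toRingHom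
  have : Algebra.FiniteType A (Localization.Away d) :=
    IsLocalization.finiteType_of_monoid_fg (Submonoid.powers d) _
  obtain ⟨χ⟩ := hPAC (Localization.Away d) (Algebra.FiniteType.trans (S := A) hA ‹_›) ‹_›
  let ψ : A →ₐ[K₀] K₀ := χ.comp (IsScalarTower.toAlgHom K₀ A _)
  have hψ : ψ d ≠ 0 := ((IsLocalization.Away.algebraMap_isUnit d).map χ).ne_zero
  let ev : K ⊗[K₀] A →ₐ[K] K := (Algebra.TensorProduct.rid K₀ K K : _ →ₐ[K] K).comp
    (Algebra.TensorProduct.map (AlgHom.id K K) ψ)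
  have hev (τ : K →ₐ[K₀] AlgebraicClosure K₀) (x) :
      τ (ev x) = evalTensor τ ((Algebra.ofId K₀ (AlgebraicClosure K₀)).comp ψ) x := by
    induction x with
    | zero => simp
    | add x y hx hy => simp_all
    | tmul x y => simp [ev, Algebra.ofId_apply, Algebra.smul_def, mul_comm]
  refine ⟨ev.comp η, (Field.primitive_element_iff_algHom_eq_of_eval' K₀ (AlgebraicClosure K₀)
    (fun x ↦ IsAlgClosed.splits _) _).mpr fun τ τ' h ↦ ?_⟩
  obtain ⟨i, rfl⟩ := σ.surjective τ
  obtain ⟨i', rfl⟩ := σ.surjective τ'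
  refine congrArg σ ((hd (AlgebraicClosure K₀)
    ((Algebra.ofId K₀ (AlgebraicClosure K₀)).comp ψ)).mp ?_ ?_)
  · simpa [Algebra.ofId_apply] using hψ
  · simpa [hev] using h
end

section
/- Let p be a prime, K a field of characteristic p, and x_1, …, x_n ∈ K elements whose differentials dx_1, …, dx_n are K-linearly independent in Ω_K (i.e. the x_i are p-independent). Let m ≥ 1, and let L/K be a field extension generated over K by a single element y satisfying y^{p^m} = x_1. Then the elements dy, dx_2, …, dx_n of Ω_L (where dx_i denotes the differential of the image of x_i in L) are L-linearly independent; in other words, y, x_2, …, x_n are p-independent in L = K(y). -/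
open TensorProduct KaehlerDifferential

open Polynomial in
theorem minpoly_eq_X_pow_sub_C_of_forall_pow_ne {K L : Type*} [Field K] [Field L] [Algebra K L]
    {p : ℕ} (hp : p.Prime) [CharP K p] {a : K} (ha : ∀ b : K, b ^ p ≠ a) {m : ℕ} {y : L}
    (hy : y ^ p ^ m = algebraMap K L a) : minpoly K y = X ^ p ^ m - C a := by
  have : ExpChar K p := .prime hp
  have : ExpChar L p := expChar_of_injective_algebraMap (algebraMap K L).injective p
  obtain ⟨k, c, hc⟩ := (minpoly.natSepDegree_eq_one_iff_eq_X_pow_sub_C p).1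
    ((minpoly.natSepDegree_eq_one_iff_pow_mem (F := K) (x := y) p).2 ⟨m, a, hy.symm⟩)
  have hyk : y ^ p ^ k = algebraMap K L c := by
    have := minpoly.aeval K y
    rw [hc] at this
    simpa [sub_eq_zero] using this
  have hkm : k ≤ m := by
    have hdvd : minpoly K y ∣ X ^ p ^ m - C a := minpoly.dvd _ _ (by simp [hy])
    have := natDegree_le_of_dvd hdvd (monic_X_pow_sub_C a (pow_pos hp.pos m).ne').ne_zero
    rw [hc, natDegree_X_pow_sub_C, natDegree_X_pow_sub_C] at this
    exact (Nat.pow_le_pow_iff_right hp.one_lt).1 this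
  obtain ⟨j, rfl⟩ := Nat.exists_eq_add_of_le hkm
  have hca : c ^ p ^ j = a := (algebraMap K L).injective (by
    rw [map_pow, ← hyk, ← hy, ← pow_mul, ← pow_add])
  cases j with
  | zero => simpa [← hca] using hc
  | succ j => exact absurd (by rw [← pow_mul, ← pow_succ, hca]) (ha (c ^ p ^ j))

open Polynomial in
theorem Derivation.exists_extend_of_pow_eq {K L : Type*} [Field K] [Field L] [Algebra K L]
    {p : ℕ} (hp : p.Prime) [CharP K p] {a : K} (ha : ∀ b : K, b ^ p ≠ a) {m : ℕ} (hm : m ≠ 0)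
    {y : L} (hy : y ^ p ^ m = algebraMap K L a) (hgen : IntermediateField.adjoin K {y} = ⊤)
    (D : Derivation ℤ K K) (hD : D a = 0) (v : K) :
    ∃ E : Derivation ℤ L L, (∀ b, E (algebraMap K L b) = algebraMap K L (D b)) ∧
      E y = algebraMap K L v := by
  let _ : Differential K := ⟨D⟩
  have hmin := minpoly_eq_X_pow_sub_C_of_forall_pow_ne hp ha hy
  have hint : IsIntegral K y := ⟨X ^ p ^ m - C a,
    monic_X_pow_sub_C a (pow_pos hp.pos m).ne', by simp [hy]⟩
  have hsurj : Function.Surjective (aeval y : K[X] →ₐ[K] L) := by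
    rw [← AlgHom.range_eq_top, ← Algebra.adjoin_singleton_eq_range_aeval,
      ← IntermediateField.adjoin_simple_toSubalgebra_of_isAlgebraic hint.isAlgebraic, hgen,
      IntermediateField.top_toSubalgebra]
  have hzero : Differential.implicitDeriv (C v) (X ^ p ^ m - C a) = 0 := by
    have hDa : Differential.deriv a = 0 := hD
    simp [hDa, hm]
  have hker (g : K[X]) (hg : aeval y g = 0) :
      aeval y (Differential.implicitDeriv (C v) g) = 0 := by
    obtain ⟨h, rfl⟩ := minpoly.dvd K y hg
    rw [Derivation.leibniz, hmin, hzero]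
    simp [hy]
  let f : K[X] →ₐ[ℤ] L := (aeval y : K[X] →ₐ[K] L).toRingHom.toIntAlgHom
  have hf (g : K[X]) : f g = aeval y g := rfl
  have hlift := Derivation.liftOfSurjective_apply (f := f) hsurj hker
  refine ⟨Derivation.liftOfSurjective (f := f) hsurj hker, fun b ↦ ?_, ?_⟩
  · have := hlift (C b)
    rwa [Differential.implicitDeriv_C, hf, hf, aeval_C, aeval_C] at this
  · have := hlift X
    rwa [Differential.implicitDeriv_X, hf, hf, aeval_C, aeval_X] at this

theorem LinearIndependent.exists_derivation {ι K : Type*} [Field K] {x : ι → K}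
    (hx : LinearIndependent K fun i ↦ D ℤ K (x i)) (i : ι) :
    ∃ E : Derivation ℤ K K, E (x i) = 1 ∧ ∀ j, j ≠ i → E (x j) = 0 := by
  obtain ⟨g, hg⟩ := (Finsupp.linearCombination K fun i ↦ D ℤ K (x i)).exists_leftInverse_of_injective
    (LinearMap.ker_eq_bot.2 hx)
  have hgx (j : ι) : g (D ℤ K (x j)) = Finsupp.single j 1 := by
    simpa using LinearMap.congr_fun hg (Finsupp.single j 1)
  exact ⟨(Finsupp.lapply i ∘ₗ g).compDer (D ℤ K), by simp [hgx],
    fun j hj ↦ by simp [hgx, Finsupp.single_eq_of_ne' hj]⟩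

theorem pow_ne_of_D_ne_zero {K : Type*} [CommRing K] {p : ℕ} [CharP K p] {a : K}
    (ha : D ℤ K a ≠ 0) (b : K) : b ^ p ≠ a := by
  rintro rfl
  refine ha ?_
  rw [Derivation.leibniz_pow, ← Nat.cast_smul_eq_nsmul K, CharP.cast_eq_zero, zero_smul]

theorem stmt13 (p : ℕ) (hp : p.Prime)
    (K : Type*) [Field K] [CharP K p]
    (n : ℕ) [NeZero n] (x : Fin n → K)
    (hx : LinearIndependent K (fun i => KaehlerDifferential.D ℤ K (x i)))
    (m : ℕ) (hm : 1 ≤ m)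
    (L : Type*) [Field L] [Algebra K L]
    (y : L) (hy : y ^ (p ^ m) = algebraMap K L (x 0))
    (hgen : IntermediateField.adjoin K {y} = ⊤) :
    LinearIndependent L (fun i : Fin n =>
      if i = 0 then KaehlerDifferential.D ℤ L y
      else KaehlerDifferential.D ℤ L (algebraMap K L (x i))) := by
  have hpow := pow_ne_of_D_ne_zero (p := p) (hx.ne_zero 0)
  have hE (i : Fin n) : ∃ E : Derivation ℤ L L, ∀ j : Fin n,
      E (if j = 0 then y else algebraMap K L (x j)) = if j = i then 1 else 0 := by
    by_cases hi : i = 0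
    · obtain ⟨E, hEK, hEy⟩ := Derivation.exists_extend_of_pow_eq hp hpow (by lia) hy hgen 0 rfl 1
      refine ⟨E, fun j ↦ ?_⟩
      by_cases hj : j = 0 <;> simp [hi, hj, hEK, hEy]
    · obtain ⟨F, hFi, hF⟩ := hx.exists_derivation i
      obtain ⟨E, hEK, hEy⟩ := Derivation.exists_extend_of_pow_eq hp hpow (by lia) hy hgen F
        (hF 0 (Ne.symm hi)) 0
      refine ⟨E, fun j ↦ ?_⟩
      by_cases hj : j = 0
      · simp [hj, hEy, Ne.symm hi]
      · by_cases hji : j = i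
        · simp [hji, hi, hEK, hFi]
        · simp [hj, hji, hEK, hF j hji]
  choose E hE using hE
  have hv : (fun i : Fin n => if i = 0 then D ℤ L y else D ℤ L (algebraMap K L (x i))) =
      fun i ↦ D ℤ L (if i = 0 then y else algebraMap K L (x i)) := by
    ext i; split_ifs <;> rfl
  rw [hv]
  refine LinearIndependent.of_pairwise_dual_eq_zero_one _
    (fun i ↦ (E i).liftKaehlerDifferential) (fun i j hij ↦ ?_) fun i ↦ ?_
  · simp [hE, Ne.symm hij]
  · simp [hE]
end

section
/- Let L be a field and O a valuation subring of L which is a henselian local ring and whose maximal ideal is generated by a single nonzero element ϖ. Then for every x ∈ L: (a) x ∈ O if and only if there exists y ∈ L with ϖ·x² = y² − y; and (b) x ∉ O if and only if there exist z, y ∈ L with z·x = 1 and z² = ϖ·(y² − y). -/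
open IsLocalRing

section ValuationSubring

variable {L : Type*} [Field L] {O : ValuationSubring L} {ϖ : O}

theorem ValuationSubring.uniformiser_mul_ne_one (hm : maximalIdeal O = Ideal.span {ϖ})
    {s : L} (hs : s ∈ O) : (ϖ : L) * s ≠ 1 := by
  intro h
  have hϖm : ϖ ∈ maximalIdeal O := hm ▸ Ideal.mem_span_singleton_self ϖ
  exact (mem_maximalIdeal ϖ).1 hϖm (IsUnit.of_mul_eq_one ⟨s, hs⟩ (Subtype.ext h))

theorem ValuationSubring.exists_uniformiser_mul_eq_inv (hm : maximalIdeal O = Ideal.span {ϖ})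
    {t : L} (ht : t ∉ O) : ∃ w ∈ O, t * ((ϖ : L) * w) = 1 := by
  have ht0 : t ≠ 0 := fun h => ht (h ▸ O.zero_mem)
  have hinv : t⁻¹ ∈ O := (O.mem_or_inv_mem t).resolve_left ht
  have hmem : (⟨t⁻¹, hinv⟩ : O) ∈ maximalIdeal O := by
    rw [mem_maximalIdeal, _root_.mem_nonunits_iff]
    intro hu
    obtain ⟨b, hb⟩ := hu.exists_right_inv
    have hb' : t⁻¹ * (b : L) = 1 := congrArg Subtype.val hb
    have : t = b := by field_simp at hb'; exact hb'.symm
    exact ht (this ▸ b.2)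
  rw [hm, Ideal.mem_span_singleton'] at hmem
  obtain ⟨w, hw⟩ := hmem
  have hw' : (w : L) * ϖ = t⁻¹ := congrArg Subtype.val hw
  exact ⟨w, w.2, by rw [mul_comm (ϖ : L), hw', mul_inv_cancel₀ ht0]⟩

theorem ValuationSubring.exists_sq_sub_self_eq_of_mem [HenselianLocalRing O]
    (hm : maximalIdeal O = Ideal.span {ϖ}) {x : L} (hx : x ∈ O) :
    ∃ y : L, (ϖ : L) * x ^ 2 = y ^ 2 - y := by
  let c : O := ϖ * ⟨x, hx⟩ ^ 2
  have hc : c ∈ maximalIdeal O :=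
    Ideal.mul_mem_right _ _ (hm ▸ Ideal.mem_span_singleton_self ϖ)
  obtain ⟨a, ha, -⟩ := HenselianLocalRing.is_henselian
    (Polynomial.X ^ 2 - Polynomial.X - Polynomial.C c) (by monicity!) 0
    (by simpa using hc) (by simp)
  have ha' : a ^ 2 - a - c = 0 := by simpa using ha
  exact ⟨a, (sub_eq_zero.1 (congrArg Subtype.val ha')).symm⟩

theorem ValuationSubring.mem_of_uniformiser_mul_sq_eq (hm : maximalIdeal O = Ideal.span {ϖ})
    {x y : L} (h : (ϖ : L) * x ^ 2 = y ^ 2 - y) : x ∈ O := by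
  by_contra hx
  by_cases hy : y ∈ O
  · obtain ⟨w, hw, hxw⟩ := exists_uniformiser_mul_eq_inv hm hx
    refine uniformiser_mul_ne_one hm
      (MulMemClass.mul_mem (pow_mem hw 2) (sub_mem (pow_mem hy 2) hy)) ?_
    linear_combination (-(ϖ : L) * w ^ 2) * h + (x * (ϖ * w) + 1) * hxw
  · have hy0 : y ≠ 0 := fun h => hy (h ▸ O.zero_mem)
    obtain ⟨v, hv, hyv⟩ := exists_uniformiser_mul_eq_inv hm hy
    have ht : (ϖ : L) * (x / y) ^ 2 = 1 - ϖ * v := by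
      field_simp
      linear_combination h + y * hyv
    by_cases htO : x / y ∈ O
    · exact uniformiser_mul_ne_one hm (AddMemClass.add_mem (pow_mem htO 2) hv)
        (by linear_combination ht)
    · obtain ⟨r, hr, htr⟩ := exists_uniformiser_mul_eq_inv hm htO
      have hϖ : (ϖ : L) ≠ 0 := by
        intro h0
        simp [h0] at htr
      refine uniformiser_mul_ne_one hm
        (MulMemClass.mul_mem (sub_mem O.one_mem (MulMemClass.mul_mem ϖ.2 hv)) (pow_mem hr 2)) ?_
      apply mul_left_cancel₀ hϖ
      linear_combination (-(ϖ : L) ^ 2 * r ^ 2) * ht + ϖ * (x / y * (ϖ * r) + 1) * htr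

end ValuationSubring

theorem stmt14 (L : Type*) [Field L] (O : ValuationSubring L)
    [HenselianLocalRing O]
    (ϖ : O) (hϖ : ϖ ≠ 0) (hm : maximalIdeal O = Ideal.span {ϖ}) :
    ∀ x : L,
      ((x ∈ O ↔ ∃ y : L, (ϖ : L) * x ^ 2 = y ^ 2 - y) ∧
        (x ∉ O ↔ ∃ z y : L, z * x = 1 ∧ z ^ 2 = (ϖ : L) * (y ^ 2 - y))) := by
  intro x
  refine ⟨⟨ValuationSubring.exists_sq_sub_self_eq_of_mem hm,
    fun ⟨_, h⟩ => ValuationSubring.mem_of_uniformiser_mul_sq_eq hm h⟩, fun hx => ?_, ?_⟩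
  · obtain ⟨w, hw, hxw⟩ := ValuationSubring.exists_uniformiser_mul_eq_inv hm hx
    obtain ⟨y, hy⟩ := ValuationSubring.exists_sq_sub_self_eq_of_mem hm hw
    exact ⟨ϖ * w, y, by rw [mul_comm, hxw], by linear_combination (ϖ : L) * hy⟩
  · rintro ⟨z, y, hzx, hz⟩ hx
    have hϖ' : (ϖ : L) ≠ 0 := fun h => hϖ (Subtype.ext h)
    have hw : z / ϖ ∈ O := by
      refine ValuationSubring.mem_of_uniformiser_mul_sq_eq hm (y := y) ?_
      field_simp
      linear_combination hz
    refine ValuationSubring.uniformiser_mul_ne_one hm (mul_mem hw hx) ?_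
    field_simp
    exact hzx
end

section
/- Let p be a prime and L/K a finitely generated extension of fields of characteristic p with transcendence degree d. Assume that the L-vector space Ω_{L/K} of relative Kähler differentials has dimension at most d + 1. Then there exist elements x_0, x_1, …, x_d ∈ L such that L = K(x_0, x_1, …, x_d), i.e. L is generated as a field extension of K by d + 1 elements. -/
open KaehlerDifferential

section PrimitiveElement

open Polynomial IntermediateField

/-- The primitive element theorem for two generators, only one of which has to be separable. -/
theorem IntermediateField.exists_adjoin_pair_eq_adjoin_simple_of_isSeparable
    {F E : Type*} [Field F] [Infinite F] [Field E] [Algebra F E] {α β : E}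
    (hα : IsIntegral F α) (hsep : IsSeparable F β) : ∃ γ : E, F⟮α, β⟯ = F⟮γ⟯ := by
  have hβ := hsep.isIntegral
  let f := minpoly F α
  let g := minpoly F β
  let ιFE := algebraMap F E
  let ιEE' := algebraMap E (SplittingField (g.map ιFE))
  obtain ⟨c, hc⟩ :=
    Field.primitive_element_inf_aux_exists_c (ιEE'.comp ιFE) (ιEE' α) (ιEE' β) f g
  let γ := α + c • β
  suffices β_in_Fγ : β ∈ F⟮γ⟯ by
    use γ
    apply le_antisymm
    · rw [adjoin_le_iff]
      have α_in_Fγ : α ∈ F⟮γ⟯ := by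
        rw [← add_sub_cancel_right α (c • β)]
        exact F⟮γ⟯.sub_mem (mem_adjoin_simple_self F γ) (F⟮γ⟯.toSubalgebra.smul_mem β_in_Fγ c)
      rintro x (rfl | rfl) <;> assumption
    · rw [adjoin_simple_le_iff]
      have α_in_Fαβ : α ∈ F⟮α, β⟯ := subset_adjoin F {α, β} (Set.mem_insert α {β})
      have β_in_Fαβ : β ∈ F⟮α, β⟯ := subset_adjoin F {α, β} (Set.mem_insert_of_mem α rfl)
      exact F⟮α, β⟯.add_mem α_in_Fαβ (F⟮α, β⟯.smul_mem β_in_Fαβ)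
  classical
  let p := EuclideanDomain.gcd ((f.map (algebraMap F F⟮γ⟯)).comp
    (C (AdjoinSimple.gen F γ) - (C ↑c : F⟮γ⟯[X]) * X)) (g.map (algebraMap F F⟮γ⟯))
  let h := EuclideanDomain.gcd ((f.map ιFE).comp (C γ - C (ιFE c) * X)) (g.map ιFE)
  have map_g_ne_zero : g.map ιFE ≠ 0 := map_ne_zero (minpoly.ne_zero hβ)
  have h_ne_zero : h ≠ 0 :=
    mt EuclideanDomain.gcd_eq_zero_iff.mp (not_and.mpr fun _ => map_g_ne_zero)
  suffices p_linear : p.map (algebraMap F⟮γ⟯ E) = C h.leadingCoeff * (X - C β) by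
    have finale : β = algebraMap F⟮γ⟯ E (-p.coeff 0 / p.coeff 1) := by
      simp [map_div₀, map_neg, ← coeff_map, ← coeff_map, p_linear,
        mul_sub, coeff_C, mul_div_cancel_left₀ β (mt leadingCoeff_eq_zero.mp h_ne_zero)]
    rw [finale]
    exact Subtype.mem (-p.coeff 0 / p.coeff 1)
  have h_sep : h.Separable := separable_gcd_right _ (.map hsep)
  have h_root : h.eval β = 0 := by
    apply eval_gcd_eq_zero
    · rw [eval_comp, eval_sub, eval_mul, eval_C, eval_C, eval_X, eval_map_algebraMap, ←
        Algebra.smul_def, add_sub_cancel_right, minpoly.aeval]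
    · rw [eval_map_algebraMap, minpoly.aeval]
  have h_splits : Splits (h.map ιEE') := by
    rw [← Polynomial.gcd_map]
    exact (SplittingField.splits _).of_dvd (map_ne_zero map_g_ne_zero)
      (EuclideanDomain.gcd_dvd_right _ _)
  have h_roots : ∀ x ∈ (h.map ιEE').roots, x = ιEE' β := by
    intro x hx
    rw [mem_roots_map h_ne_zero] at hx
    specialize hc (ιEE' γ - ιEE' (ιFE c) * x) (by
      have f_root := root_left_of_root_gcd hx
      rw [eval₂_comp, eval₂_sub, eval₂_mul, eval₂_C, eval₂_C, eval₂_X, eval₂_map] at f_root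
      exact (mem_roots_map (minpoly.ne_zero hα)).mpr f_root)
    specialize hc x (by
      rw [mem_roots_map (minpoly.ne_zero hβ), ← eval₂_map]
      exact root_right_of_root_gcd hx)
    by_contra a
    apply hc
    apply (div_eq_iff (sub_ne_zero.mpr a)).mpr
    simp only [γ, Algebra.smul_def, map_add, map_mul, RingHom.comp_apply]
    ring
  rw [← eq_X_sub_C_of_separable_of_root_eq h_sep h_root h_splits h_roots]
  trans EuclideanDomain.gcd (?_ : E[X]) (?_ : E[X])
  · dsimp only [γ]
    convert! (gcd_map (algebraMap F⟮γ⟯ E)).symm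
  · simp only [map_comp, Polynomial.map_map, ← IsScalarTower.algebraMap_eq, Polynomial.map_sub,
      map_C, AdjoinSimple.algebraMap_gen, Polynomial.map_mul, map_X]
    congr

/-- A finite extension that is separable over a simple subextension is simple. -/
theorem Field.exists_primitive_element_of_isSeparable_adjoin_simple
    {F E : Type*} [Field F] [Field E] [Algebra F E] [FiniteDimensional F E] (x : E)
    [Algebra.IsSeparable F⟮x⟯ E] : ∃ γ : E, F⟮γ⟯ = ⊤ := by
  cases finite_or_infinite F
  · exact Field.exists_primitive_element_of_finite_bot F E
  obtain ⟨z, hz⟩ := Field.exists_primitive_element F (separableClosure F E)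
  obtain ⟨γ, hγ⟩ := exists_adjoin_pair_eq_adjoin_simple_of_isSeparable
    (Algebra.IsIntegral.isIntegral (R := F) x) (mem_separableClosure_iff.mp z.2)
  refine ⟨γ, ?_⟩
  rw [← hγ]
  have hx : F⟮x⟯ ≤ F⟮x, (z : E)⟯ := adjoin.mono _ _ _ (by simp)
  have hS : separableClosure F E ≤ F⟮x, (z : E)⟯ := by
    have : F⟮(z : E)⟯ = separableClosure F E := by
      simpa [lift_adjoin_simple] using congrArg lift hz
    exact this.ge.trans (adjoin.mono _ _ _ (by simp))
  let := (inclusion hx).toRingHom.toAlgebra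
  let := (inclusion hS).toRingHom.toAlgebra
  have : IsScalarTower F⟮x⟯ F⟮x, (z : E)⟯ E := .of_algebraMap_eq fun _ ↦ rfl
  have : IsScalarTower (separableClosure F E) F⟮x, (z : E)⟯ E := .of_algebraMap_eq fun _ ↦ rfl
  have := Algebra.isSeparable_tower_top_of_isSeparable F⟮x⟯ F⟮x, (z : E)⟯ E
  have := IsPurelyInseparable.tower_top (separableClosure F E) F⟮x, (z : E)⟯ E
  refine eq_top_iff.mpr fun e _ ↦ ?_
  obtain ⟨y, rfl⟩ :=
    IsPurelyInseparable.surjective_algebraMap_of_isSeparable F⟮x, (z : E)⟯ E e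
  exact y.2

end PrimitiveElement

/-- If `Ω[L⁄K]` has dimension at most `n`, then it is spanned by `n` exact differentials. -/
theorem KaehlerDifferential.exists_span_range_D_eq_top {K L : Type*} [CommRing K] [Field L]
    [Algebra K L] (n : ℕ) (h : Module.rank L (Ω[L⁄K]) ≤ n) :
    ∃ x : Fin n → L, Submodule.span L (Set.range fun i ↦ D K L (x i)) = ⊤ := by
  obtain ⟨t, ht, hspan, hli⟩ := exists_linearIndependent L (Set.range (D K L))
  rw [span_range_derivation] at hspan
  have hcard : Cardinal.mk t ≤ n := hli.cardinal_le_rank.trans h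
  have : Finite t := Cardinal.lt_aleph0_iff_finite.mp (hcard.trans_lt Cardinal.natCast_lt_aleph0)
  have := Fintype.ofFinite t
  obtain ⟨e⟩ : Nonempty (t ↪ Fin n) :=
    Function.Embedding.nonempty_of_card_le (by simpa using hcard)
  choose g hg using fun w : t ↦ ht w.2
  refine ⟨Function.extend e g 0, eq_top_iff.mpr (hspan ▸ Submodule.span_mono fun w hw ↦ ?_)⟩
  exact ⟨e ⟨w, hw⟩, by simp [e.injective.extend_apply, hg]⟩

theorem Algebra.FormallyUnramified.of_span_range_D_eq_top {ι K A L : Type*} [CommRing K]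
    [CommRing A] [CommRing L] [Algebra K A] [Algebra K L] [Algebra A L] [IsScalarTower K A L]
    (x : ι → L) (hx : Submodule.span L (Set.range fun i ↦ D K L (x i)) = ⊤)
    (hA : ∀ i, x i ∈ Set.range (algebraMap A L)) : Algebra.FormallyUnramified A L := by
  refine ⟨subsingleton_of_forall_eq 0 fun w ↦ ?_⟩
  obtain ⟨v, rfl⟩ := map_surjective K A L w
  suffices ⊤ ≤ LinearMap.ker (map K A L L) from this trivial
  rw [← hx, Submodule.span_le]
  rintro _ ⟨i, rfl⟩
  obtain ⟨a, ha⟩ := hA i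
  simp [← ha]

theorem stmt15 (p : ℕ) (hp : p.Prime)
    (K L : Type*) [Field K] [Field L] [Algebra K L] [CharP K p]
    (hfg : ∃ s : Finset L, IntermediateField.adjoin K (s : Set L) = ⊤)
    (d : ℕ) (b : Fin d → L) (hb : IsTranscendenceBasis K b)
    (hdim : Module.rank L (Ω[L⁄K]) ≤ d + 1) :
    ∃ x : Fin (d + 1) → L, IntermediateField.adjoin K (Set.range x) = ⊤ := by
  have : Algebra.EssFiniteType K L := IntermediateField.fg_top_iff.mp hfg
  obtain ⟨x, hx⟩ := exists_span_range_D_eq_top (K := K) (L := L) (d + 1) (by simpa using hdim)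
  have hsep (A : Type _) [Field A] [Algebra K A] [Algebra A L] [IsScalarTower K A L]
      (hA : ∀ i, x i ∈ Set.range (algebraMap A L)) : Algebra.IsSeparable A L := by
    have := Algebra.FormallyUnramified.of_span_range_D_eq_top x hx hA
    have := Algebra.EssFiniteType.of_comp K A L
    exact Algebra.FormallyUnramified.isSeparable A L
  have : Algebra.IsSeparable (IntermediateField.adjoin K (Set.range x)) L :=
    hsep _ fun i ↦ ⟨⟨x i, IntermediateField.subset_adjoin _ _ ⟨i, rfl⟩⟩, rfl⟩
  have : Algebra.IsAlgebraic (Algebra.adjoin K (Set.range x)) L :=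
    IntermediateField.isAlgebraic_adjoin_iff_top.mp inferInstance
  obtain ⟨t, ht, htb⟩ := exists_isTranscendenceBasis_subset (R := K) (Set.range x)
  choose g hg using fun w : t ↦ ht w.2
  -- Some index is not needed to cover the transcendence basis `t`.
  obtain ⟨i₀, hi₀⟩ : ∃ i₀, ∀ w, g w ≠ i₀ := by
    by_contra! hsurj
    have hcard : Cardinal.mk t = d := by simpa using (hb.lift_cardinalMk_eq htb).symm
    have : Finite t :=
      Cardinal.lt_aleph0_iff_finite.mp (hcard.trans_lt Cardinal.natCast_lt_aleph0)
    have hle := Nat.card_le_card_of_surjective g hsurj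
    simp [Nat.card, hcard] at hle
  set F := IntermediateField.adjoin K (x '' {i₀}ᶜ) with hF
  have htF : IntermediateField.adjoin K t ≤ F :=
    IntermediateField.adjoin.mono _ _ _ fun w hw ↦ ⟨g ⟨w, hw⟩, hi₀ _, hg ⟨w, hw⟩⟩
  have : Algebra.IsAlgebraic F L := by
    have halg := htb.isAlgebraic_field
    rw [Subtype.range_coe] at halg
    let := (IntermediateField.inclusion htF).toRingHom.toAlgebra
    have : IsScalarTower (IntermediateField.adjoin K t) F L := .of_algebraMap_eq fun _ ↦ rfl
    exact Algebra.IsAlgebraic.tower_top (K := IntermediateField.adjoin K t) F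
  have := Algebra.EssFiniteType.of_comp K F L
  have := Algebra.finite_of_essFiniteType_of_isAlgebraic (F := F) (E := L)
  have : IsScalarTower K (IntermediateField.adjoin F {x i₀}) L := .of_algebraMap_eq fun _ ↦ rfl
  have : Algebra.IsSeparable (IntermediateField.adjoin F {x i₀}) L := hsep _ fun i ↦ by
    obtain rfl | hi := eq_or_ne i i₀
    · exact ⟨⟨x i, IntermediateField.mem_adjoin_simple_self _ _⟩, rfl⟩
    · exact ⟨algebraMap F _ ⟨x i, IntermediateField.subset_adjoin _ _ ⟨i, hi, rfl⟩⟩, rfl⟩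
  obtain ⟨γ, hγ⟩ := Field.exists_primitive_element_of_isSeparable_adjoin_simple (F := F) (x i₀)
  have hsub : x '' {i₀}ᶜ ∪ {γ} ⊆ Set.range (Function.update x i₀ γ) := by
    rintro _ (⟨i, hi, rfl⟩ | rfl)
    · exact ⟨i, Function.update_of_ne hi _ _⟩
    · exact ⟨i₀, Function.update_self ..⟩
  refine ⟨Function.update x i₀ γ, eq_top_iff.mpr ?_⟩
  rw [← IntermediateField.restrictScalars_top (K := K) (F := F), ← hγ, hF,
    IntermediateField.adjoin_adjoin_left]
  exact IntermediateField.adjoin.mono _ _ _ hsub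
end
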